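/- arXiv:2601.14193 — 2 statements merged into one kernel-verified Lean document; each statement's English description precedes it below -/
import Mathlib

section
/- Let n ≥ 1 and let Φ be a translation invariant curvature measure on ℝⁿ that is homogeneous of degree n. Then there exists a constant α ∈ ℂ such that Φ(K, β) = α · λ(K ∩ β) for every convex body K in ℝⁿ and every Borel set β ⊆ ℝⁿ, where λ denotes the Lebesgue measure on ℝⁿ. -/
open MeasureTheory Metric Filter Topology
open scoped Pointwise

/-- ℝⁿ as Euclidean space. -/
abbrev Rn (n : ℕ) := EuclideanSpace ℝ (Fin n)

/-- A convex body: a nonempty compact convex subset of ℝⁿ. -/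
def IsConvexBody {n : ℕ} (K : Set (Rn n)) : Prop :=
  K.Nonempty ∧ IsCompact K ∧ Convex ℝ K

/-- Integral of a complex-valued function against a finite complex Borel measure,
defined via the Jordan decompositions of the real and imaginary parts. -/
noncomputable def cmIntegral {n : ℕ} (μ : ComplexMeasure (Rn n)) (f : Rn n → ℂ) : ℂ :=
  ((∫ x, f x ∂(ComplexMeasure.re μ).toJordanDecomposition.posPart)
    - (∫ x, f x ∂(ComplexMeasure.re μ).toJordanDecomposition.negPart))
  + Complex.I * ((∫ x, f x ∂(ComplexMeasure.im μ).toJordanDecomposition.posPart)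
    - (∫ x, f x ∂(ComplexMeasure.im μ).toJordanDecomposition.negPart))

/-- The total variation measure of a finite complex Borel measure (a set is null for this
measure iff it is null for the classical total variation measure). -/
noncomputable def cmVariation {n : ℕ} (μ : ComplexMeasure (Rn n)) : Measure (Rn n) :=
  (ComplexMeasure.re μ).totalVariation + (ComplexMeasure.im μ).totalVariation

/-- A translation invariant curvature measure on ℝⁿ: a map assigning to each convex body
a finite complex Borel measure, which is local, translation invariant, and weakly continuous
with respect to Hausdorff convergence of convex bodies. -/
structure CurvatureMeasure (n : ℕ) where
  /-- the finite complex Borel measure associated to a convex body -/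
  meas : Set (Rn n) → ComplexMeasure (Rn n)
  locality : ∀ K L U : Set (Rn n), IsConvexBody K → IsConvexBody L → IsOpen U →
    K ∩ U = L ∩ U → ∀ β : Set (Rn n), MeasurableSet β → β ⊆ U → meas K β = meas L β
  translation_invariant : ∀ K : Set (Rn n), IsConvexBody K → ∀ x : Rn n,
    ∀ β : Set (Rn n), MeasurableSet β →
      meas ((fun y => y + x) '' K) ((fun y => y + x) '' β) = meas K β
  continuity : ∀ (Ki : ℕ → Set (Rn n)) (K : Set (Rn n)), (∀ i, IsConvexBody (Ki i)) →
    IsConvexBody K → Tendsto (fun i => hausdorffDist (Ki i) K) atTop (𝓝 0) →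
    ∀ f : BoundedContinuousFunction (Rn n) ℂ,
      Tendsto (fun i => cmIntegral (meas (Ki i)) f) atTop (𝓝 (cmIntegral (meas K) f))

/-- A curvature measure is homogeneous of degree `k`. -/
def CurvatureMeasure.Homogeneous {n : ℕ} (Φ : CurvatureMeasure n) (k : ℕ) : Prop :=
  ∀ t : ℝ, 0 < t → ∀ K : Set (Rn n), IsConvexBody K → ∀ β : Set (Rn n), MeasurableSet β →
    Φ.meas (t • K) (t • β) = (t : ℂ) ^ k * Φ.meas K β

/-- A curvature measure is SO(n) invariant: invariant under every orientation preserving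
linear isometry (rotation) of ℝⁿ. -/
def CurvatureMeasure.SOInvariant {n : ℕ} (Φ : CurvatureMeasure n) : Prop :=
  ∀ ρ : Rn n ≃ₗᵢ[ℝ] Rn n, 0 < LinearMap.det (ρ.toLinearEquiv : Rn n →ₗ[ℝ] Rn n) →
    ∀ K : Set (Rn n), IsConvexBody K → ∀ β : Set (Rn n), MeasurableSet β →
      Φ.meas (ρ '' K) (ρ '' β) = Φ.meas K β

section helpers
variable {n : ℕ}

lemma cm_re_apply (μ : ComplexMeasure (Rn n)) (A : Set (Rn n)) :
    (ComplexMeasure.re μ) A = (μ A).re := rfl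
lemma cm_im_apply (μ : ComplexMeasure (Rn n)) (A : Set (Rn n)) :
    (ComplexMeasure.im μ) A = (μ A).im := rfl

instance totVar_finite (s : SignedMeasure (Rn n)) : IsFiniteMeasure s.totalVariation := by
  unfold SignedMeasure.totalVariation; infer_instance

instance cmVar_finite (μ : ComplexMeasure (Rn n)) : IsFiniteMeasure (cmVariation μ) := by
  unfold cmVariation; infer_instance

lemma cm_norm_le_var (μ : ComplexMeasure (Rn n)) (A : Set (Rn n)) :
    ‖μ A‖ ≤ (cmVariation μ).real A := by
  have h1 := SignedMeasure.norm_le_totalVariation (ComplexMeasure.re μ) A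
  have h2 := SignedMeasure.norm_le_totalVariation (ComplexMeasure.im μ) A
  rw [cm_re_apply, Real.norm_eq_abs] at h1
  rw [cm_im_apply, Real.norm_eq_abs] at h2
  have h3 := Complex.norm_le_abs_re_add_abs_im (μ A)
  have h4 : (cmVariation μ).real A = (ComplexMeasure.re μ).totalVariation.real A
      + (ComplexMeasure.im μ).totalVariation.real A := by
    unfold cmVariation
    exact measureReal_add_apply
  linarith

lemma signed_var_le (s : SignedMeasure (Rn n)) (A : Set (Rn n)) (hA : MeasurableSet A) (C : ℝ)
    (h : ∀ β, MeasurableSet β → β ⊆ A → |s β| ≤ C) : s.totalVariation.real A ≤ 2 * C := by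
  obtain ⟨i, hi₁, hi₂, hi₃, hp, hn⟩ := s.toJordanDecomposition_spec
  unfold SignedMeasure.totalVariation
  rw [measureReal_add_apply, hp, hn, SignedMeasure.toMeasureOfZeroLE_real_apply _ hi₂ hi₁ hA,
    SignedMeasure.toMeasureOfLEZero_real_apply _ hi₃ hi₁.compl hA]
  have h1 := h (i ∩ A) (hi₁.inter hA) Set.inter_subset_right
  have h2 := h (iᶜ ∩ A) (hi₁.compl.inter hA) Set.inter_subset_right
  have := le_abs_self (s (i ∩ A))
  have := neg_le_abs (s (iᶜ ∩ A))
  linarith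

lemma cm_var_le (μ : ComplexMeasure (Rn n)) (A : Set (Rn n)) (hA : MeasurableSet A) (C : ℝ)
    (h : ∀ β, MeasurableSet β → β ⊆ A → ‖μ β‖ ≤ C) : (cmVariation μ).real A ≤ 4 * C := by
  have h1 := signed_var_le (ComplexMeasure.re μ) A hA C
    (fun β hβ hs => (Complex.abs_re_le_norm _).trans (h β hβ hs))
  have h2 := signed_var_le (ComplexMeasure.im μ) A hA C
    (fun β hβ hs => (Complex.abs_im_le_norm _).trans (h β hβ hs))
  have h4 : (cmVariation μ).real A = (ComplexMeasure.re μ).totalVariation.real A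
      + (ComplexMeasure.im μ).totalVariation.real A := by
    unfold cmVariation
    exact measureReal_add_apply
  linarith

/-- the integral as a continuous linear functional -/
noncomputable def cmCLM (μ : ComplexMeasure (Rn n)) :
    BoundedContinuousFunction (Rn n) ℂ →L[ℂ] ℂ :=
  LinearMap.mkContinuousOfExistsBound
    { toFun := fun f => cmIntegral μ f
      map_add' := by
        intro f g
        unfold cmIntegral
        simp only [BoundedContinuousFunction.coe_add, Pi.add_apply]
        rw [integral_add (f.integrable _) (g.integrable _),
          integral_add (f.integrable _) (g.integrable _),
          integral_add (f.integrable _) (g.integrable _),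
          integral_add (f.integrable _) (g.integrable _)]
        ring
      map_smul' := by
        intro c f
        unfold cmIntegral
        simp only [BoundedContinuousFunction.coe_smul, smul_eq_mul, integral_const_mul, RingHom.id_apply]
        ring }
    (by
      have key : ∀ (ν : Measure (Rn n)) [IsFiniteMeasure ν]
          (f : BoundedContinuousFunction (Rn n) ℂ), ‖∫ x, f x ∂ν‖ ≤ ν.real Set.univ * ‖f‖ :=
        fun ν _ f => f.norm_integral_le_mul_norm ν
      set p := (ComplexMeasure.re μ).toJordanDecomposition.posPart with hp
      set q := (ComplexMeasure.re μ).toJordanDecomposition.negPart with hq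
      set p' := (ComplexMeasure.im μ).toJordanDecomposition.posPart with hp'
      set q' := (ComplexMeasure.im μ).toJordanDecomposition.negPart with hq'
      refine ⟨p.real Set.univ + q.real Set.univ + (p'.real Set.univ + q'.real Set.univ), fun f => ?_⟩
      change ‖cmIntegral μ f‖ ≤ _
      unfold cmIntegral
      refine (norm_add_le _ _).trans ?_
      rw [norm_mul, Complex.norm_I, one_mul]
      have h1 := norm_sub_le (∫ x, f x ∂p) (∫ x, f x ∂q)
      have h2 := norm_sub_le (∫ x, f x ∂p') (∫ x, f x ∂q')
      have := key p f
      have := key q f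
      have := key p' f
      have := key q' f
      linarith)

lemma cmCLM_apply (μ : ComplexMeasure (Rn n)) (f) : cmCLM μ f = cmIntegral μ f := rfl

lemma cm_apply_eq (μ : ComplexMeasure (Rn n)) {A : Set (Rn n)} (hA : MeasurableSet A) :
    μ A = cmIntegral μ (A.indicator 1) := by
  unfold cmIntegral
  rw [← Complex.re_add_im (μ A), ← cm_re_apply, ← cm_im_apply,
    SignedMeasure.apply_eq_posPart_real_sub_negPart_real _ hA,
    SignedMeasure.apply_eq_posPart_real_sub_negPart_real _ hA]
  have : ∀ (ν : Measure (Rn n)) [IsFiniteMeasure ν],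
      ∫ x, A.indicator (1 : Rn n → ℂ) x ∂ν = (ν.real A : ℂ) := by
    intro ν _
    rw [integral_indicator hA]
    simp
  simp only [this]
  push_cast
  ring

/-- complex-valued thickened indicator -/
noncomputable def thickC (δ : ℝ) (hδ : 0 < δ) (F : Set (Rn n)) :
    BoundedContinuousFunction (Rn n) ℂ :=
  BoundedContinuousFunction.ofNormedAddCommGroup
    (fun x => (((thickenedIndicator hδ F x : NNReal) : ℝ) : ℂ)) (by fun_prop) 1 (by
      intro x
      have := thickenedIndicator_le_one hδ F x
      simp only [Complex.norm_real, NNReal.norm_eq]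
      exact_mod_cast this)

lemma cm_closed_bound (μ : ComplexMeasure (Rn n)) (C : ℝ) (hC : 0 ≤ C)
    (h : ∀ f : BoundedContinuousFunction (Rn n) ℂ, ‖cmIntegral μ f‖ ≤ C * ‖f‖)
    (F : Set (Rn n)) (hF : IsClosed F) : ‖μ F‖ ≤ C := by
  have δ : ∀ k : ℕ, 0 < 1 / ((k : ℝ) + 1) := fun k => by positivity
  set g : ℕ → BoundedContinuousFunction (Rn n) ℂ := fun k => thickC _ (δ k) F with hg
  have hb : ∀ k x, ‖g k x‖ ≤ 1 := by
    intro k x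
    have := thickenedIndicator_le_one (δ k) F x
    change ‖(((thickenedIndicator (δ k) F x : NNReal) : ℝ) : ℂ)‖ ≤ 1
    simp only [Complex.norm_real, NNReal.norm_eq]
    exact_mod_cast this
  have hlim : ∀ x, Tendsto (fun k => g k x) atTop (𝓝 (F.indicator 1 x)) := by
    intro x
    have := thickenedIndicator_tendsto_indicator_closure δ tendsto_one_div_add_atTop_nhds_zero_nat F
    rw [tendsto_pi_nhds] at this
    have hx := this x
    rw [hF.closure_eq] at hx
    have h2 : Tendsto (fun k => (((thickenedIndicator (δ k) F x : NNReal) : ℝ) : ℂ)) atTop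
        (𝓝 (((F.indicator (fun _ => (1 : NNReal)) x : NNReal) : ℝ) : ℂ)) :=
      ((Complex.continuous_ofReal.comp NNReal.continuous_coe).tendsto _).comp hx
    have h3 : F.indicator (1 : Rn n → ℂ) x
        = (((F.indicator (fun _ => (1 : NNReal)) x : NNReal) : ℝ) : ℂ) := by
      by_cases hxF : x ∈ F <;> simp [hxF]
    rw [h3]
    exact h2
  have hint : ∀ (ν : Measure (Rn n)) [IsFiniteMeasure ν],
      Tendsto (fun k => ∫ x, g k x ∂ν) atTop (𝓝 (∫ x, F.indicator 1 x ∂ν)) := by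
    intro ν _
    exact tendsto_integral_of_dominated_convergence (fun _ => 1)
      (fun k => (g k).continuous.aestronglyMeasurable) (integrable_const _)
      (fun k => Eventually.of_forall (hb k)) (Eventually.of_forall hlim)
  have ht : Tendsto (fun k => cmIntegral μ (g k)) atTop (𝓝 (μ F)) := by
    rw [cm_apply_eq μ hF.measurableSet]
    unfold cmIntegral
    exact ((hint _).sub (hint _)).add (((hint _).sub (hint _)).const_mul _)
  refine le_of_tendsto ht.norm (Eventually.of_forall fun k => ?_)
  refine (h (g k)).trans ?_
  have : ‖g k‖ ≤ 1 := (BoundedContinuousFunction.norm_le zero_le_one).2 (hb k)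
  nlinarith

lemma cm_bound (μ : ComplexMeasure (Rn n)) (C : ℝ) (hC : 0 ≤ C)
    (h : ∀ f : BoundedContinuousFunction (Rn n) ℂ, ‖cmIntegral μ f‖ ≤ C * ‖f‖)
    (A : Set (Rn n)) (hA : MeasurableSet A) : ‖μ A‖ ≤ C := by
  refine le_of_forall_pos_le_add fun ε hε => ?_
  obtain ⟨F, hFA, hF, hlt⟩ := hA.exists_isClosed_sdiff_lt (μ := cmVariation μ)
    (measure_ne_top _ _) (ε := ENNReal.ofReal ε) (by simpa using hε)
  have h1 : μ A = μ F + μ (A \ F) := by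
    rw [VectorMeasure.of_add_of_sdiff hF.measurableSet hA hFA]
  have h2 := cm_norm_le_var μ (A \ F)
  have h3 : (cmVariation μ).real (A \ F) ≤ ε :=
    ENNReal.toReal_le_of_le_ofReal hε.le hlt.le
  have h4 := cm_closed_bound μ C hC h F hF
  rw [h1]
  have := norm_add_le (μ F) (μ (A \ F))
  linarith

lemma convex_limit (L : ℕ → TopologicalSpace.NonemptyCompacts (Rn n))
    (K : TopologicalSpace.NonemptyCompacts (Rn n)) (hL : ∀ i, Convex ℝ (L i : Set (Rn n)))
    (h : Tendsto L atTop (𝓝 K)) : Convex ℝ (K : Set (Rn n)) := by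
  intro x hx y hy a b ha hb hab
  have hz : infDist (a • x + b • y) (K : Set (Rn n)) ≤ 0 := by
    refine le_of_forall_pos_le_add fun ε hε => ?_
    obtain ⟨i, hi⟩ := ((Metric.tendsto_nhds.1 h) (ε / 2) (by positivity)).exists
    have hfin := hausdorffEDist_ne_top_of_nonempty_of_bounded K.nonempty (L i).nonempty
      K.isCompact.isBounded (L i).isCompact.isBounded
    have hfin' := hausdorffEDist_ne_top_of_nonempty_of_bounded (L i).nonempty K.nonempty
      (L i).isCompact.isBounded K.isCompact.isBounded
    have hd : hausdorffDist (L i : Set (Rn n)) K < ε / 2 := hi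
    have hd' : hausdorffDist (K : Set (Rn n)) (L i) < ε / 2 := by rwa [hausdorffDist_comm]
    have hmem : ∀ w ∈ (K : Set (Rn n)), w ∈ thickening (ε / 2) (L i : Set (Rn n)) := by
      intro w hw
      rw [mem_thickening_iff_infDist_lt (L i).nonempty]
      exact (infDist_le_hausdorffDist_of_mem hw hfin).trans_lt hd'
    have := (hL i).thickening (ε / 2) (hmem x hx) (hmem y hy) ha hb hab
    rw [mem_thickening_iff_infDist_lt (L i).nonempty] at this
    have h2 := infDist_le_infDist_add_hausdorffDist (x := a • x + b • y) hfin'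
    linarith
  have := (K.isCompact.isClosed.mem_iff_infDist_zero K.nonempty).2 (le_antisymm hz infDist_nonneg)
  exact this

lemma uniform_bound (Φ : CurvatureMeasure n) :
    ∃ M : ℝ, 0 ≤ M ∧ ∀ L : Set (Rn n), IsConvexBody L → L ⊆ closedBall 0 1 →
      ∀ β, MeasurableSet β → ‖Φ.meas L β‖ ≤ M := by
  by_contra hcon
  push Not at hcon
  choose! L hL hLB β hβ hlt using fun k : ℕ => hcon k (Nat.cast_nonneg k)
  let L' : ℕ → TopologicalSpace.NonemptyCompacts (Rn n) :=
    fun k => ⟨⟨L k, (hL k).2.1⟩, (hL k).1⟩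
  obtain ⟨K, -, φ, hφ, hlim⟩ :=
    (TopologicalSpace.NonemptyCompacts.isCompact_subsets_of_isCompact
      (isCompact_closedBall (0 : Rn n) 1)).tendsto_subseq (x := L') (fun k => hLB k)
  have hK : IsConvexBody (K : Set (Rn n)) :=
    ⟨K.nonempty, K.isCompact, convex_limit (L' ∘ φ) K (fun i => (hL (φ i)).2.2) hlim⟩
  have hcont := Φ.continuity (fun i => L (φ i)) K (fun i => hL _) hK
    (tendsto_iff_dist_tendsto_zero.1 hlim)
  obtain ⟨C, hC⟩ := banach_steinhaus (g := fun i => cmCLM (Φ.meas (L (φ i)))) (by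
    intro f
    obtain ⟨C, hC⟩ := (hcont f).norm.bddAbove_range
    exact ⟨C, fun i => hC ⟨i, rfl⟩⟩)
  have hC0 : 0 ≤ C := (norm_nonneg _).trans (hC 0)
  obtain ⟨k, hk⟩ := exists_nat_gt C
  have h1 := cm_bound (Φ.meas (L (φ k))) C hC0 (fun f =>
    ((cmCLM _).le_opNorm f).trans (mul_le_mul_of_nonneg_right (hC k) (norm_nonneg _)))
    (β (φ k)) (hβ _)
  have h2 := hlt (φ k)
  have h3 : (k : ℝ) ≤ φ k := by exact_mod_cast hφ.id_le k
  linarith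

/-- Normalisation: translate `x` to the origin and rescale by `r⁻¹`. -/
def nrm (x : Rn n) (r : ℝ) (A : Set (Rn n)) : Set (Rn n) := r⁻¹ • ((fun y => y + -x) '' A)

lemma mem_nrm {x : Rn n} {r : ℝ} (hr : 0 < r) {A : Set (Rn n)} {y : Rn n} :
    y ∈ nrm x r A ↔ r • y + x ∈ A := by
  unfold nrm
  rw [Set.mem_inv_smul_set_iff₀ hr.ne']
  simp

lemma nrm_measurable {x : Rn n} {r : ℝ} (hr : 0 < r) {A : Set (Rn n)} (hA : MeasurableSet A) :
    MeasurableSet (nrm x r A) := by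
  have : nrm x r A = (fun y => r • y + x) ⁻¹' A := by
    ext y; exact mem_nrm hr
  rw [this]
  exact (by fun_prop : Measurable fun y : Rn n => r • y + x) hA

lemma nrm_body {x : Rn n} {r : ℝ} {A : Set (Rn n)} (hA : IsConvexBody A) :
    IsConvexBody ((fun y => y + -x) '' A) ∧ IsConvexBody (nrm x r A) := by
  have h : IsConvexBody ((fun y => y + -x) '' A) := by
    refine ⟨hA.1.image _, hA.2.1.image (by fun_prop), ?_⟩
    have := hA.2.2.translate (-x)
    have h2 : (fun y : Rn n => y + -x) = fun y => -x + y := funext fun y => add_comm _ _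
    rw [h2]
    exact this
  exact ⟨h, h.1.smul_set, h.2.1.smul _, h.2.2.smul _⟩

lemma nrm_closedBall {x : Rn n} {r : ℝ} (hr : 0 < r) (s : ℝ) :
    nrm x r (closedBall x (r * s)) = closedBall 0 s := by
  ext y
  rw [mem_nrm hr, mem_closedBall, mem_closedBall, dist_eq_norm, dist_eq_norm, add_sub_cancel_right,
    sub_zero, norm_smul, Real.norm_of_nonneg hr.le, mul_le_mul_iff_right₀ hr]

lemma meas_nrm (Φ : CurvatureMeasure n) (hΦ : Φ.Homogeneous n) {x : Rn n} {r : ℝ} (hr : 0 < r)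
    {L β : Set (Rn n)} (hL : IsConvexBody L) (hβ : MeasurableSet β) :
    Φ.meas L β = (r : ℂ) ^ n * Φ.meas (nrm x r L) (nrm x r β) := by
  have hβ' : MeasurableSet ((fun y => y + -x) '' β) := by
    rw [Set.image_add_right]
    exact (by fun_prop : Measurable fun y : Rn n => y + - -x) hβ
  unfold nrm
  rw [hΦ r⁻¹ (inv_pos.2 hr) _ (nrm_body (r := r) hL).1 _ hβ',
    Φ.translation_invariant L hL _ β hβ, ← mul_assoc, ← mul_pow]
  have : (r : ℂ) ≠ 0 := by exact_mod_cast hr.ne'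
  simp [this]

lemma local_bound (Φ : CurvatureMeasure n) (hΦ : Φ.Homogeneous n) :
    ∃ M : ℝ, 0 ≤ M ∧ ∀ K : Set (Rn n), IsConvexBody K → ∀ x ∈ K, ∀ r : ℝ, 0 < r →
      ∀ β, MeasurableSet β → β ⊆ ball x r → ‖Φ.meas K β‖ ≤ M * r ^ n := by
  obtain ⟨M, hM, h⟩ := uniform_bound Φ
  refine ⟨M, hM, fun K hK x hx r hr β hβ hβs => ?_⟩
  have hL : IsConvexBody (K ∩ closedBall x r) :=
    ⟨⟨x, hx, mem_closedBall_self hr.le⟩, hK.2.1.inter_right isClosed_closedBall,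
      hK.2.2.inter (convex_closedBall x r)⟩
  rw [Φ.locality K (K ∩ closedBall x r) (ball x r) hK hL isOpen_ball (by
    rw [Set.inter_assoc, Set.inter_eq_self_of_subset_right ball_subset_closedBall]) β hβ hβs,
    meas_nrm Φ hΦ (x := x) hr hL hβ, norm_mul, norm_pow, Complex.norm_real,
    Real.norm_of_nonneg hr.le, mul_comm]
  refine mul_le_mul_of_nonneg_right (h _ (nrm_body hL).2 ?_ _ (nrm_measurable hr hβ)) (by positivity)
  rw [← nrm_closedBall (x := x) hr 1, mul_one]
  intro y hy
  rw [mem_nrm hr] at hy ⊢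
  exact hy.2

lemma boundary_null (Φ : CurvatureMeasure n) (hΦ : Φ.Homogeneous n) (K : Set (Rn n))
    (hK : IsConvexBody K) (N : Set (Rn n)) (hN : MeasurableSet N) (hNK : N ⊆ K)
    (h0 : volume N = 0) : Φ.meas K N = 0 := by
  obtain ⟨M, hM, hb⟩ := local_bound Φ hΦ
  set v := cmVariation (Φ.meas K) with hv
  have hvb : ∀ x ∈ K, ∀ r : ℝ, 0 < r →
      v (closedBall x r) ≤ ENNReal.ofReal (4 * M * 2 ^ n) * ENNReal.ofReal (r ^ n) := by
    intro x hx r hr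
    have := cm_var_le (Φ.meas K) (closedBall x r) measurableSet_closedBall (M * (2 * r) ^ n)
      (fun β hβ hs => hb K hK x hx (2 * r) (by positivity) β hβ
        (hs.trans (closedBall_subset_ball (by linarith))))
    rw [← ENNReal.ofReal_mul (by positivity), ← ENNReal.ofReal_toReal (measure_ne_top v _)]
    apply ENNReal.ofReal_le_ofReal
    refine this.trans (le_of_eq ?_)
    rw [mul_pow]; ring
  set ω := volume (closedBall (0 : Rn n) 1) with hω
  have hω0 : ω ≠ 0 := (measure_closedBall_pos volume _ one_pos).ne'
  have hωt : ω ≠ ⊤ := measure_closedBall_lt_top.ne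
  have hvol : ∀ x : Rn n, ∀ r : ℝ, 0 < r →
      volume (closedBall x r) = ENNReal.ofReal (r ^ n) * ω := by
    intro x r hr
    rw [Measure.addHaar_closedBall' _ _ hr.le]
    simp [hω]
  set D : ENNReal := ENNReal.ofReal (4 * M * 2 ^ n) / ω with hD
  have hDt : D ≠ ⊤ := ENNReal.div_ne_top ENNReal.ofReal_ne_top hω0
  have hvb' : ∀ x ∈ K, ∀ r : ℝ, 0 < r → v (closedBall x r) ≤ D * volume (closedBall x r) := by
    intro x hx r hr
    refine (hvb x hx r hr).trans (le_of_eq ?_)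
    rw [hvol x r hr, hD, mul_comm (ENNReal.ofReal (r ^ n)), ← mul_assoc,
      ENNReal.div_mul_cancel hω0 hωt]
  have hvN : ∀ ε : ENNReal, ε ≠ 0 → v N ≤ D * ε := by
    intro ε hε
    obtain ⟨t, r, htc, htN, hr, hcov, hsum⟩ :=
      Besicovitch.exists_closedBall_covering_tsum_measure_le (volume : Measure (Rn n)) hε
        (fun _ => Set.Ioi 0) N (fun x _ δ hδ => ⟨δ / 2, by simp [hδ], by simp [hδ]⟩)
    have := htc.to_subtype
    calc v N ≤ v (⋃ x ∈ t, closedBall x (r x)) := measure_mono hcov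
      _ = v (⋃ x : t, closedBall (x : Rn n) (r x)) := by rw [Set.biUnion_eq_iUnion]
      _ ≤ ∑' x : t, v (closedBall (x : Rn n) (r x)) := measure_iUnion_le _
      _ ≤ ∑' x : t, D * volume (closedBall (x : Rn n) (r x)) :=
        ENNReal.tsum_le_tsum fun x => hvb' x (hNK (htN x.2)) _ (hr x x.2)
      _ = D * ∑' x : t, volume (closedBall (x : Rn n) (r x)) := ENNReal.tsum_mul_left
      _ ≤ D * ε := by
        rw [h0, zero_add] at hsum
        gcongr
  have hvN' : v.real N ≤ 0 := by
    refine le_of_forall_pos_le_add fun ε hε => ?_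
    have hDn : 0 ≤ D.toReal := ENNReal.toReal_nonneg
    have h1 := hvN (ENNReal.ofReal (ε / (D.toReal + 1))) (by
      have : 0 < ε / (D.toReal + 1) := by positivity
      simpa using this)
    have h2 := ENNReal.toReal_mono (ENNReal.mul_ne_top hDt ENNReal.ofReal_ne_top) h1
    rw [ENNReal.toReal_mul, ENNReal.toReal_ofReal (by positivity)] at h2
    refine h2.trans ?_
    rw [zero_add, mul_div_assoc', div_le_iff₀ (by positivity)]
    nlinarith
  exact norm_le_zero_iff.1 ((cm_norm_le_var _ _).trans hvN')

lemma outside_ball (hn : 1 ≤ n) (Φ : CurvatureMeasure n) (K : Set (Rn n)) (hK : IsConvexBody K)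
    (x : Rn n) (r : ℝ) (hr : 0 < r) (hKb : K ∩ ball x r = ∅) (β : Set (Rn n))
    (hβ : MeasurableSet β) (hs : β ⊆ ball x r) : Φ.meas K β = 0 := by
  set e : Rn n := EuclideanSpace.single ⟨0, hn⟩ (1 : ℝ) with he
  have hen : ‖e‖ = 1 := by simp [he]
  have hpt : ∀ y : Rn n, IsConvexBody ({y} : Set (Rn n)) := fun y =>
    ⟨Set.singleton_nonempty y, isCompact_singleton, convex_singleton y⟩
  set w : ℕ → Rn n := fun k => ((k : ℝ) * (2 * r)) • e with hw
  set x0 : Rn n := x - (2 * r) • e with hx0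
  have hB : ∀ k, MeasurableSet ((fun y => y + w k) '' β) := by
    intro k
    rw [Set.image_add_right]
    exact (by fun_prop : Measurable fun y : Rn n => y + - w k) hβ
  have hval : ∀ k, Φ.meas {x0} ((fun y => y + w k) '' β) = Φ.meas K β := by
    intro k
    have h1 := Φ.translation_invariant {x0 - w k} (hpt _) (w k) β hβ
    rw [Set.image_singleton, sub_add_cancel] at h1
    rw [h1]
    refine Φ.locality _ _ (ball x r) (hpt _) hK isOpen_ball ?_ β hβ hs
    rw [hKb, Set.singleton_inter_eq_empty, mem_ball, dist_eq_norm]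
    have : x0 - w k - x = (-(((k : ℝ) + 1) * (2 * r))) • e := by
      rw [hx0, hw]; module
    rw [this, norm_smul, hen, mul_one, norm_neg, Real.norm_of_nonneg (by positivity)]
    have : (0 : ℝ) ≤ k := Nat.cast_nonneg k
    nlinarith
  have hdisj : Pairwise (Function.onFun Disjoint fun k => (fun y => y + w k) '' β) := by
    intro j k hjk
    refine Set.disjoint_left.2 ?_
    rintro _ ⟨a, ha, rfl⟩ ⟨b, hb, hab⟩
    have h1 := hs ha
    have h2 := hs hb
    rw [mem_ball, dist_eq_norm] at h1 h2
    have h3 : (a - x) - (b - x) = (((k : ℝ) - j) * (2 * r)) • e := by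
      have : b + ((k : ℝ) * (2 * r)) • e = a + ((j : ℝ) * (2 * r)) • e := hab
      have h4 : a = b + ((k : ℝ) * (2 * r)) • e - ((j : ℝ) * (2 * r)) • e := by
        rw [this]; abel
      rw [h4]; module
    have h5 := norm_sub_le (a - x) (b - x)
    rw [h3, norm_smul, hen, mul_one, norm_mul, Real.norm_of_nonneg (by positivity : 0 ≤ 2 * r)] at h5
    have h6 : (1 : ℝ) ≤ ‖(k : ℝ) - j‖ := by
      rw [Real.norm_eq_abs]
      have : (1 : ℤ) ≤ |(k : ℤ) - j| := Int.one_le_abs (by omega)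
      exact_mod_cast this
    nlinarith
  have hsum := (Φ.meas {x0}).m_iUnion hB hdisj
  change HasSum (fun k => Φ.meas {x0} ((fun y => y + w k) '' β)) _ at hsum
  simp only [hval] at hsum
  exact (summable_const_iff _).1 hsum.summable

lemma outside_null (hn : 1 ≤ n) (Φ : CurvatureMeasure n) (K : Set (Rn n)) (hK : IsConvexBody K)
    (β : Set (Rn n)) (hs : β ⊆ Kᶜ) : Φ.meas K β = 0 := by
  have h0 : cmVariation (Φ.meas K) Kᶜ = 0 := by
    refine measure_null_of_locally_null _ fun x hx => ?_
    obtain ⟨r, hr, hsub⟩ := Metric.isOpen_iff.1 hK.2.1.isClosed.isOpen_compl x hx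
    refine ⟨ball x r, mem_nhdsWithin_of_mem_nhds (ball_mem_nhds x hr), ?_⟩
    have h1 := cm_var_le (Φ.meas K) (ball x r) measurableSet_ball 0 (fun γ hγ hγs => by
      rw [outside_ball hn Φ K hK x r hr (by
        rw [← Set.disjoint_iff_inter_eq_empty]
        exact (Set.disjoint_left.2 fun y hy hyK => hsub hy hyK).symm) γ hγ hγs]
      simp)
    rw [mul_zero] at h1
    exact (measureReal_eq_zero_iff).1 (le_antisymm h1 measureReal_nonneg)
  have h1 : (cmVariation (Φ.meas K)).real β = 0 := by
    rw [measureReal_eq_zero_iff]; exact measure_mono_null hs h0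
  exact norm_le_zero_iff.1 ((cm_norm_le_var _ _).trans h1.le)

/-- complex measure attached to Lebesgue measure on `K` -/
noncomputable def lebK (K : Set (Rn n)) [IsFiniteMeasure (volume.restrict K)] :
    ComplexMeasure (Rn n) :=
  SignedMeasure.toComplexMeasure (volume.restrict K).toSignedMeasure 0

lemma lebK_apply (K : Set (Rn n)) [IsFiniteMeasure (volume.restrict K)] {β : Set (Rn n)}
    (hβ : MeasurableSet β) : lebK K β = ((volume (K ∩ β)).toReal : ℂ) := by
  unfold lebK
  rw [SignedMeasure.toComplexMeasure_apply, Measure.toSignedMeasure_apply_measurable hβ,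
    Measure.real, Measure.restrict_apply hβ, Set.inter_comm]
  rfl

lemma ball_value (Φ : CurvatureMeasure n) (hΦ : Φ.Homogeneous n) (K : Set (Rn n))
    (hK : IsConvexBody K) (x : Rn n) (r : ℝ) (hr : 0 < r) (hs : ball x (r * 2) ⊆ K) :
    Φ.meas K (closedBall x r) =
      (Φ.meas (closedBall 0 2) (closedBall 0 1) / ((volume (closedBall (0 : Rn n) 1)).toReal : ℂ))
        * ((volume (closedBall x r)).toReal : ℂ) := by
  have hL : IsConvexBody (closedBall x (r * 2)) :=
    ⟨⟨x, mem_closedBall_self (by positivity)⟩, isCompact_closedBall _ _, convex_closedBall _ _⟩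
  rw [Φ.locality K (closedBall x (r * 2)) (ball x (r * 2)) hK hL isOpen_ball (by
    rw [Set.inter_eq_self_of_subset_right hs,
      Set.inter_eq_self_of_subset_right ball_subset_closedBall]) _ measurableSet_closedBall
      (closedBall_subset_ball (by linarith)),
    meas_nrm Φ hΦ (x := x) hr hL measurableSet_closedBall, nrm_closedBall hr]
  have h1 : nrm x r (closedBall x r) = closedBall 0 1 := by
    rw [← nrm_closedBall (x := x) hr 1, mul_one]
  rw [h1, Measure.addHaar_closedBall' _ x hr.le, ENNReal.toReal_mul,
    ENNReal.toReal_ofReal (by positivity)]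
  have hω0 : ((volume (closedBall (0 : Rn n) 1)).toReal : ℂ) ≠ 0 := by
    have : 0 < (volume (closedBall (0 : Rn n) 1)).toReal :=
      ENNReal.toReal_pos (measure_closedBall_pos volume _ one_pos).ne' measure_closedBall_lt_top.ne
    exact_mod_cast this.ne'
  simp only [finrank_euclideanSpace, Fintype.card_fin]
  push_cast
  field_simp

lemma open_zero (μ : ComplexMeasure (Rn n)) (K : Set (Rn n))
    (h : ∀ x r, 0 < r → ball x (r * 2) ⊆ K → μ (closedBall x r) = 0)
    (U : Set (Rn n)) (hU : IsOpen U) (hUK : U ⊆ K) : μ U = 0 := by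
  obtain ⟨t, r, htc, htU, hr, hcov, hdisj⟩ :=
    Besicovitch.exists_disjoint_closedBall_covering_ae (cmVariation μ)
      (fun x => {r | 0 < r ∧ ball x (r * 2) ⊆ U}) U (by
        intro x hx δ hδ
        obtain ⟨ρ, hρ, hsub⟩ := Metric.isOpen_iff.1 hU x hx
        have hm : 0 < min (ρ / 2) (δ / 2) := lt_min (by positivity) (by positivity)
        refine ⟨min (ρ / 2) (δ / 2), ⟨hm, (ball_subset_ball ?_).trans hsub⟩, hm, ?_⟩
        · have := min_le_left (ρ / 2) (δ / 2)
          linarith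
        · have := min_le_right (ρ / 2) (δ / 2)
          linarith) (fun _ => 1) (fun _ _ => one_pos)
  have := htc.to_subtype
  rw [Set.biUnion_eq_iUnion] at hcov
  have hVm : MeasurableSet (⋃ x : t, closedBall (x : Rn n) (r x)) :=
    MeasurableSet.iUnion fun _ => measurableSet_closedBall
  have hVU : (⋃ x : t, closedBall (x : Rn n) (r x)) ⊆ U := by
    refine Set.iUnion_subset fun x => ?_
    have := (hr x x.2).1
    exact (closedBall_subset_ball (by linarith [this.1])).trans this.2
  rw [← VectorMeasure.of_add_of_sdiff hVm hU.measurableSet hVU]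
  have h1 : μ (U \ ⋃ x : t, closedBall (x : Rn n) (r x)) = 0 := by
    refine norm_le_zero_iff.1 ((cm_norm_le_var _ _).trans ?_)
    rw [Measure.real, hcov]; simp
  have h2 := VectorMeasure.hasSum_of_disjoint_iUnion (v := μ)
    (f := fun x : t => closedBall (x : Rn n) (r x)) (fun _ => measurableSet_closedBall)
    (fun x y hxy => hdisj x.2 y.2 (fun hh => hxy (Subtype.ext hh)))
  have h3 : ∀ x : t, μ (closedBall (x : Rn n) (r x)) = 0 := fun x =>
    h x (r x) (hr x x.2).1.1 ((hr x x.2).1.2.trans hUK)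
  simp only [h3] at h2
  rw [h1, add_zero, h2.unique hasSum_zero]

lemma interior_zero (μ : ComplexMeasure (Rn n)) (K : Set (Rn n))
    (h : ∀ x r, 0 < r → ball x (r * 2) ⊆ K → μ (closedBall x r) = 0)
    (β : Set (Rn n)) (hβ : MeasurableSet β) (hβK : β ⊆ interior K) : μ β = 0 := by
  refine norm_le_zero_iff.1 (le_of_forall_pos_le_add fun ε hε => ?_)
  obtain ⟨U, hβU, hU, -, hlt⟩ := hβ.exists_isOpen_sdiff_lt (μ := cmVariation μ)
    (measure_ne_top _ _) (ε := ENNReal.ofReal ε) (by simpa using hε)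
  have hV : IsOpen (U ∩ interior K) := hU.inter isOpen_interior
  have h1 := VectorMeasure.of_add_of_sdiff (v := μ) hβ hV.measurableSet (Set.subset_inter hβU hβK)
  rw [open_zero μ K h _ hV (Set.inter_subset_right.trans interior_subset)] at h1
  rw [eq_neg_of_add_eq_zero_left h1, norm_neg, zero_add]
  refine (cm_norm_le_var _ _).trans (ENNReal.toReal_le_of_le_ofReal hε.le ?_)
  exact (measure_mono (Set.sdiff_subset_sdiff_left Set.inter_subset_left)).trans hlt.le

end helpers


/-- Every translation invariant curvature measure on ℝⁿ that is homogeneous of degree n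
is a constant multiple of the localized Lebesgue measure (K, β) ↦ λ(K ∩ β). -/
theorem curvatureMeasure_top_degree_eq_smul_lebesgue (n : ℕ) (hn : 1 ≤ n)
    (Φ : CurvatureMeasure n) (hΦ : Φ.Homogeneous n) :
    ∃ α : ℂ, ∀ K : Set (Rn n), IsConvexBody K → ∀ β : Set (Rn n), MeasurableSet β →
      Φ.meas K β = α * ((MeasureTheory.volume (K ∩ β)).toReal : ℂ) := by
  refine ⟨Φ.meas (closedBall 0 2) (closedBall 0 1) /
    ((volume (closedBall (0 : Rn n) 1)).toReal : ℂ), fun K hK β hβ => ?_⟩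
  set α : ℂ := Φ.meas (closedBall 0 2) (closedBall 0 1) /
    ((volume (closedBall (0 : Rn n) 1)).toReal : ℂ) with hα
  have : IsFiniteMeasure (volume.restrict K) := ⟨by
    rw [Measure.restrict_apply_univ]; exact hK.2.1.measure_lt_top⟩
  have hKm : MeasurableSet K := hK.2.1.measurableSet
  have hIm : MeasurableSet (interior K) := isOpen_interior.measurableSet
  have hfr : volume (K \ interior K) = 0 := by
    rw [← hK.2.1.isClosed.frontier_eq]
    exact hK.2.2.addHaar_frontier volume
  have hint : Φ.meas K (β ∩ interior K) = α * ((volume (β ∩ interior K)).toReal : ℂ) := by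
    have := interior_zero (Φ.meas K - α • lebK K) K (by
      intro x r hr hs
      have hsub : closedBall x r ⊆ K := (closedBall_subset_ball (by linarith)).trans hs
      rw [VectorMeasure.sub_apply, VectorMeasure.smul_apply, lebK_apply K measurableSet_closedBall,
        Set.inter_eq_self_of_subset_right hsub, ball_value Φ hΦ K hK x r hr hs, smul_eq_mul, sub_self])
      (β ∩ interior K) (hβ.inter hIm) Set.inter_subset_right
    rw [VectorMeasure.sub_apply, VectorMeasure.smul_apply, lebK_apply K (hβ.inter hIm),
      Set.inter_eq_self_of_subset_right (Set.inter_subset_right.trans interior_subset),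
      smul_eq_mul, sub_eq_zero] at this
    exact this
  have h1 := VectorMeasure.of_add_of_sdiff (v := Φ.meas K) (hβ.inter hKm) hβ Set.inter_subset_left
  have h2 := VectorMeasure.of_add_of_sdiff (v := Φ.meas K) (hβ.inter hIm) (hβ.inter hKm)
    (Set.inter_subset_inter_right β interior_subset)
  have h3 : Φ.meas K (β \ (β ∩ K)) = 0 :=
    outside_null hn Φ K hK _ (fun y hy hyK => hy.2 ⟨hy.1, hyK⟩)
  have hsub : (β ∩ K) \ (β ∩ interior K) ⊆ K \ interior K :=
    fun y hy => ⟨hy.1.2, fun hyI => hy.2 ⟨hy.1.1, hyI⟩⟩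
  have h4 : Φ.meas K ((β ∩ K) \ (β ∩ interior K)) = 0 :=
    boundary_null Φ hΦ K hK _ ((hβ.inter hKm).diff (hβ.inter hIm)) (hsub.trans Set.diff_subset)
      (measure_mono_null hsub hfr)
  have h5 : volume (K ∩ β) = volume (β ∩ interior K) := by
    rw [Set.inter_comm]
    refine le_antisymm ?_ (measure_mono (Set.inter_subset_inter_right β interior_subset))
    calc volume (β ∩ K) ≤ volume ((β ∩ interior K) ∪ ((β ∩ K) \ (β ∩ interior K))) :=
          measure_mono (fun y hy => by
            by_cases hyI : y ∈ β ∩ interior K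
            · exact Or.inl hyI
            · exact Or.inr ⟨hy, hyI⟩)
      _ ≤ volume (β ∩ interior K) + volume ((β ∩ K) \ (β ∩ interior K)) := measure_union_le _ _
      _ = volume (β ∩ interior K) := by rw [measure_mono_null hsub hfr, add_zero]
  rw [← h1, h3, add_zero, ← h2, h4, add_zero, hint, h5]
end

section
/- Let Φ be a translation invariant curvature measure on ℝⁿ such that Φ(K, ℝⁿ) = 0 for every convex body K, and such that for every convex body K and every index i ∈ {1,…,n} the integral of the i-th coordinate function x_i against the measure Φ(K,·) vanishes (these integrals are well defined since Φ(K,·) is supported in the compact set K). Then Φ(K, β) = 0 for every convex body K and every Borel set β ⊆ ℝⁿ. -/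
open MeasureTheory Metric Filter Topology
open scoped Pointwise

open scoped BoundedContinuousFunction InnerProductSpace

section Abs
universe u

def CB {E : Type u} [NormedAddCommGroup E] [InnerProductSpace ℝ E] (K : Set E) : Prop :=
  K.Nonempty ∧ IsCompact K ∧ Convex ℝ K

structure IsCurv {E : Type u} [NormedAddCommGroup E] [InnerProductSpace ℝ E]
    (Φ : Set E → ((E →ᵇ ℝ) →L[ℝ] ℝ)) : Prop where
  loc : ∀ K L U : Set E, CB K → CB L → IsOpen U → K ∩ U = L ∩ U →
    ∀ f : E →ᵇ ℝ, (∀ x, x ∉ U → f x = 0) → Φ K f = Φ L f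
  supp : ∀ K : Set E, CB K → ∀ f : E →ᵇ ℝ, (∀ x ∈ K, f x = 0) → Φ K f = 0
  trans : ∀ K : Set E, CB K → ∀ (x : E) (f g : E →ᵇ ℝ), (∀ y, g y = f (y + x)) →
    Φ ((fun y => y + x) '' K) f = Φ K g
  cont : ∀ (Ki : ℕ → Set E) (K : Set E), (∀ i, CB (Ki i)) → CB K → (∀ i, K ⊆ Ki i) →
    ∀ ε : ℕ → ℝ, Tendsto ε atTop (𝓝 0) → (∀ i, ∀ x ∈ Ki i, ∃ y ∈ K, dist x y ≤ ε i) →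
    ∀ f : E →ᵇ ℝ, Tendsto (fun i => Φ (Ki i) f) atTop (𝓝 (Φ K f))
  aff : ∀ K : Set E, CB K → ∀ (l : E →L[ℝ] ℝ) (c : ℝ) (f : E →ᵇ ℝ),
    (∀ x ∈ K, f x = l x + c) → Φ K f = 0

variable {E : Type u} [NormedAddCommGroup E] [InnerProductSpace ℝ E]

lemma IsCurv.congr {Φ : Set E → ((E →ᵇ ℝ) →L[ℝ] ℝ)} (hΦ : IsCurv Φ) {K : Set E} (hK : CB K)
    (f g : E →ᵇ ℝ) (h : ∀ x ∈ K, f x = g x) : Φ K f = Φ K g := by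
  have := hΦ.supp K hK (f - g) (fun x hx => by simp [h x hx])
  rw [map_sub] at this; linarith

/-- projection to the orthogonal complement of e -/
noncomputable def pr (e : E) : E →L[ℝ] (ℝ ∙ e)ᗮ := (ℝ ∙ e)ᗮ.orthogonalProjectionOnto

lemma pr_decomp (e : E) (he : ‖e‖ = 1) (x : E) : ((pr e x : (ℝ ∙ e)ᗮ) : E) + (inner ℝ e x : ℝ) • e = x := by
  have h := Submodule.starProjection_add_starProjection_orthogonal (K := (ℝ ∙ e)) x
  rw [Submodule.starProjection_singleton] at h
  simp only [he] at h
  rw [add_comm]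
  simpa [pr] using h

lemma inner_W (e : E) (w : (ℝ ∙ e)ᗮ) : inner ℝ e (w : E) = 0 :=
  Submodule.mem_orthogonal_singleton_iff_inner_right.1 w.2

lemma pr_W (e : E) (w : (ℝ ∙ e)ᗮ) : pr e (w : E) = w := by
  simp [pr]

lemma pr_e (e : E) (he : ‖e‖ = 1) : pr e e = 0 := by
  have h := pr_decomp e he e
  rw [real_inner_self_eq_norm_sq, he] at h
  simpa using h

lemma pr_shift (e : E) (he : ‖e‖ = 1) (x : E) (s : ℝ) : pr e (x + s • e) = pr e x := by
  simp [pr_e e he]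

lemma inner_shift (e : E) (he : ‖e‖ = 1) (x : E) (s : ℝ) :
    (inner ℝ e (x + s • e) : ℝ) = inner ℝ e x + s := by
  rw [inner_add_right, inner_smul_right, real_inner_self_eq_norm_sq, he]; ring

def prism (e : E) (K : Set (ℝ ∙ e)ᗮ) (a b : ℝ) : Set E :=
  {x | pr e x ∈ K ∧ (inner ℝ e x : ℝ) ∈ Set.Icc a b}

lemma prism_CB (e : E) (he : ‖e‖ = 1) (K : Set (ℝ ∙ e)ᗮ) (hK : CB K) (a b : ℝ) (hab : a ≤ b) :
    CB (prism e K a b) := by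
  have himg : prism e K a b =
      (fun p : (ℝ ∙ e)ᗮ × ℝ => (p.1 : E) + p.2 • e) '' (K ×ˢ Set.Icc a b) := by
    ext x
    constructor
    · rintro ⟨h1, h2⟩
      exact ⟨(pr e x, inner ℝ e x), ⟨h1, h2⟩, pr_decomp e he x⟩
    · rintro ⟨⟨w, t⟩, ⟨h1, h2⟩, rfl⟩
      constructor
      · simpa only [pr_shift e he, pr_W] using h1
      · simpa only [inner_shift e he, inner_W, zero_add] using h2
  refine ⟨?_, ?_, ?_⟩
  · rw [himg]
    exact (hK.1.prod (Set.nonempty_Icc.2 hab)).image _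
  · rw [himg]
    exact (hK.2.1.prod isCompact_Icc).image (by fun_prop)
  · have h1 : Convex ℝ ((pr e : E →L[ℝ] (ℝ ∙ e)ᗮ) ⁻¹' K) :=
      hK.2.2.linear_preimage (pr e : E →ₗ[ℝ] (ℝ ∙ e)ᗮ)
    have h2 : Convex ℝ ((innerSL ℝ e : E →L[ℝ] ℝ) ⁻¹' (Set.Icc a b)) :=
      (convex_Icc a b).linear_preimage ((innerSL ℝ e : E →L[ℝ] ℝ) : E →ₗ[ℝ] ℝ)
    exact h1.inter h2

lemma prism_shift (e : E) (he : ‖e‖ = 1) (K : Set (ℝ ∙ e)ᗮ) (a b s : ℝ) :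
    prism e K a b = (fun y => y + s • e) '' prism e K (a - s) (b - s) := by
  ext x
  constructor
  · rintro ⟨h1, h2⟩
    refine ⟨x + (-s) • e, ⟨by rwa [pr_shift e he], ?_⟩, by simp⟩
    rw [inner_shift e he]
    constructor <;> linarith [h2.1, h2.2]
  · rintro ⟨y, ⟨h1, h2⟩, rfl⟩
    refine ⟨by simpa only [pr_shift e he] using h1, ?_⟩
    simp only [inner_shift e he]
    constructor <;> linarith [h2.1, h2.2]

lemma prism_shiftW (e : E) (K : Set (ℝ ∙ e)ᗮ) (a b : ℝ) (w : (ℝ ∙ e)ᗮ) :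
    prism e ((fun y => y + w) '' K) a b = (fun y => y + (w : E)) '' prism e K a b := by
  ext x
  constructor
  · rintro ⟨⟨k, hk, h1⟩, h2⟩
    refine ⟨x - w, ⟨?_, ?_⟩, by simp⟩
    · rw [map_sub, pr_W, ← h1]; simpa using hk
    · simpa [inner_sub_right, inner_W] using h2
  · rintro ⟨y, ⟨h1, h2⟩, rfl⟩
    refine ⟨⟨pr e y, h1, by simp [pr_W]⟩, ?_⟩
    simpa [inner_add_right, inner_W] using h2

/-- f ⊗ θ -/
noncomputable def ten (e : E) (f : (ℝ ∙ e)ᗮ →ᵇ ℝ) (θ : ℝ →ᵇ ℝ) : E →ᵇ ℝ :=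
  (f.compContinuous ⟨pr e, (pr e).continuous⟩) *
    (θ.compContinuous ⟨fun x => inner ℝ e x, by fun_prop⟩)

lemma ten_apply (e : E) (f : (ℝ ∙ e)ᗮ →ᵇ ℝ) (θ : ℝ →ᵇ ℝ) (x : E) :
    ten e f θ x = f (pr e x) * θ (inner ℝ e x) := rfl

noncomputable def tenL (e : E) (θ : ℝ →ᵇ ℝ) : ((ℝ ∙ e)ᗮ →ᵇ ℝ) →L[ℝ] (E →ᵇ ℝ) :=
  LinearMap.mkContinuous
    { toFun := fun f => ten e f θ
      map_add' := fun f g => by ext x; simp [ten_apply, add_mul]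
      map_smul' := fun c f => by ext x; simp [ten_apply, mul_assoc] } ‖θ‖ (by
    intro f
    refine (BoundedContinuousFunction.norm_le (by positivity)).2 fun x => ?_
    change ‖f (pr e x) * θ (inner ℝ e x)‖ ≤ _
    rw [norm_mul, mul_comm]
    exact mul_le_mul (θ.norm_coe_le_norm _) (f.norm_coe_le_norm _) (norm_nonneg _) (norm_nonneg _))

lemma tenL_apply (e : E) (θ : ℝ →ᵇ ℝ) (f : (ℝ ∙ e)ᗮ →ᵇ ℝ) : tenL e θ f = ten e f θ := rfl

noncomputable def eta (δ s : ℝ) : ℝ →ᵇ ℝ :=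
  BoundedContinuousFunction.ofNormedAddCommGroup (fun t => max 0 (min 1 (1 - (t - s) / δ)))
    (by fun_prop) 1 (by
      intro x
      rw [Real.norm_eq_abs, abs_of_nonneg (le_max_left _ _)]
      exact max_le zero_le_one (min_le_left _ _))

lemma eta_apply (δ s t : ℝ) : eta δ s t = max 0 (min 1 (1 - (t - s) / δ)) := rfl

lemma eta_one (δ s t : ℝ) (hδ : 0 < δ) (h : t ≤ s) : eta δ s t = 1 := by
  rw [eta_apply, min_eq_left, max_eq_right zero_le_one]
  have : (t - s) / δ ≤ 0 := div_nonpos_of_nonpos_of_nonneg (by linarith) hδ.le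
  linarith

lemma eta_zero (δ s t : ℝ) (hδ : 0 < δ) (h : s + δ ≤ t) : eta δ s t = 0 := by
  rw [eta_apply, max_eq_left]
  refine (min_le_right _ _).trans ?_
  have : 1 ≤ (t - s) / δ := by rw [le_div_iff₀ hδ]; linarith
  linarith

lemma eta_mono (δ s s' t : ℝ) (hδ : 0 < δ) (h : s ≤ s') : eta δ s t ≤ eta δ s' t := by
  rw [eta_apply, eta_apply]
  gcongr

lemma eta_nonneg (δ s t : ℝ) : 0 ≤ eta δ s t := le_max_left _ _
lemma eta_le_one (δ s t : ℝ) : eta δ s t ≤ 1 := max_le zero_le_one (min_le_left _ _)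

lemma prismF_zero {Φ : Set E → ((E →ᵇ ℝ) →L[ℝ] ℝ)} (hΦ : IsCurv Φ) (e : E) (he : ‖e‖ = 1)
    (a b δ s : ℝ) (hδ : 0 < δ) (has : a ≤ s) (hb : s + 2 * δ ≤ b)
    (K : Set (ℝ ∙ e)ᗮ) (hK : CB K) (l : (ℝ ∙ e)ᗮ →L[ℝ] ℝ) (c : ℝ) (f : (ℝ ∙ e)ᗮ →ᵇ ℝ)
    (hf : ∀ x ∈ K, f x = l x + c) :
    Φ (prism e K a b) (ten e f (eta δ (s + δ) - eta δ s)) = 0 := by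
  have c1 : CB (prism e K a b) := prism_CB e he K hK a b (by linarith)
  have c2 : CB (prism e K (a - δ) (b - δ)) := prism_CB e he K hK _ _ (by linarith)
  have c3 : CB (prism e K (a - δ) b) := prism_CB e he K hK _ _ (by linarith)
  have hin : Continuous fun x : E => (inner ℝ e x : ℝ) := by fun_prop
  have e1 : Φ (prism e K a b) (ten e f (eta δ (s + δ))) =
      Φ (prism e K (a - δ) (b - δ)) (ten e f (eta δ s)) := by
    rw [prism_shift e he K a b δ]
    apply hΦ.trans _ c2
    intro y
    simp only [ten_apply, pr_shift e he, inner_shift e he, eta_apply]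
    congr 5
    ring
  have e2 : Φ (prism e K (a - δ) (b - δ)) (ten e f (eta δ s)) =
      Φ (prism e K (a - δ) b) (ten e f (eta δ s)) := by
    apply hΦ.loc _ _ {x : E | (inner ℝ e x : ℝ) < b - δ} c2 c3 (isOpen_lt hin continuous_const)
    · ext x
      simp only [prism, Set.mem_inter_iff, Set.mem_ofPred_eq, Set.mem_Icc]
      constructor
      · rintro ⟨⟨h1, h2, h3⟩, h4⟩; exact ⟨⟨h1, h2, by linarith⟩, h4⟩
      · rintro ⟨⟨h1, h2, h3⟩, h4⟩; exact ⟨⟨h1, h2, by linarith⟩, h4⟩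
    · intro x hx
      simp only [Set.mem_ofPred_eq, not_lt] at hx
      rw [ten_apply, eta_zero δ s _ hδ (by linarith), mul_zero]
  have e3 : ∀ a' b' : ℝ, a' ≤ b' → Φ (prism e K a' b') (ten e f 1) = 0 := by
    intro a' b' hab
    apply hΦ.aff _ (prism_CB e he K hK _ _ hab) (l.comp (pr e)) c
    intro x hx
    rw [ten_apply, hf _ hx.1]; simp
  have e4 : Φ (prism e K (a - δ) b) (ten e f (1 - eta δ s)) =
      Φ (prism e K a b) (ten e f (1 - eta δ s)) := by
    apply hΦ.loc _ _ {x : E | a < (inner ℝ e x : ℝ)} c3 c1 (isOpen_lt continuous_const hin)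
    · ext x
      simp only [prism, Set.mem_inter_iff, Set.mem_ofPred_eq, Set.mem_Icc]
      constructor
      · rintro ⟨⟨h1, h2, h3⟩, h4⟩; exact ⟨⟨h1, by linarith, by linarith⟩, h4⟩
      · rintro ⟨⟨h1, h2, h3⟩, h4⟩; exact ⟨⟨h1, by linarith, by linarith⟩, h4⟩
    · intro x hx
      simp only [Set.mem_ofPred_eq, not_lt] at hx
      simp [ten_apply, eta_one δ s _ hδ (show (inner ℝ e x : ℝ) ≤ s by linarith)]
  have hs : ∀ θ θ' : ℝ →ᵇ ℝ, ten e f (θ - θ') = ten e f θ - ten e f θ' := by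
    intro θ θ'; ext x; simp [ten_apply, mul_sub]
  rw [hs, map_sub] at e4 ⊢
  rw [map_sub] at e4
  have := e3 (a - δ) b (by linarith)
  have := e3 a b (by linarith)
  linarith

lemma isCurv_prism {Φ : Set E → ((E →ᵇ ℝ) →L[ℝ] ℝ)} (hΦ : IsCurv Φ) (e : E) (he : ‖e‖ = 1)
    (a b δ s : ℝ) (hδ : 0 < δ) (has : a ≤ s) (hb : s + 2 * δ ≤ b) :
    IsCurv (fun K : Set (ℝ ∙ e)ᗮ => (Φ (prism e K a b)).comp (tenL e (eta δ (s + δ) - eta δ s))) where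
  loc := by
    intro K L U hK hL hU hKL f hf
    simp only [ContinuousLinearMap.comp_apply, tenL_apply]
    apply hΦ.loc _ _ (pr e ⁻¹' U) (prism_CB e he K hK a b (by linarith))
      (prism_CB e he L hL a b (by linarith)) (hU.preimage (pr e).continuous)
    · ext x
      have : pr e x ∈ K ∩ U ↔ pr e x ∈ L ∩ U := by rw [hKL]
      simp only [Set.mem_inter_iff] at this
      simp only [prism, Set.mem_inter_iff, Set.mem_ofPred_eq, Set.mem_preimage]
      tauto
    · intro x hx
      rw [ten_apply, hf _ hx, zero_mul]
  supp := by
    intro K hK f hf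
    simp only [ContinuousLinearMap.comp_apply, tenL_apply]
    apply hΦ.supp _ (prism_CB e he K hK a b (by linarith))
    intro x hx
    rw [ten_apply, hf _ hx.1, zero_mul]
  trans := by
    intro K hK x f g hfg
    simp only [ContinuousLinearMap.comp_apply, tenL_apply]
    rw [prism_shiftW]
    apply hΦ.trans _ (prism_CB e he K hK a b (by linarith))
    intro y
    rw [ten_apply, ten_apply, hfg, map_add (pr e), pr_W, inner_add_right, inner_W, add_zero]
  cont := by
    intro Ki K hKi hK hsub ε hε hd f
    simp only [ContinuousLinearMap.comp_apply, tenL_apply]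
    apply hΦ.cont _ _ (fun i => prism_CB e he (Ki i) (hKi i) a b (by linarith))
      (prism_CB e he K hK a b (by linarith)) _ ε hε
    · intro i x hx
      obtain ⟨k, hk, hkd⟩ := hd i _ hx.1
      refine ⟨(k : E) + (inner ℝ e x : ℝ) • e, ⟨?_, ?_⟩, ?_⟩
      · rwa [pr_shift e he, pr_W]
      · rw [inner_shift e he, inner_W, zero_add]; exact hx.2
      · conv_lhs => rw [← pr_decomp e he x]
        rw [inner_add_right, inner_W, inner_smul_right, real_inner_self_eq_norm_sq, he]
        rw [Subtype.dist_eq] at hkd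
        simpa using hkd
    · intro i x hx
      exact ⟨hsub i hx.1, hx.2⟩
  aff := by
    intro K hK l c f hf
    simp only [ContinuousLinearMap.comp_apply, tenL_apply]
    exact prismF_zero hΦ e he a b δ s hδ has hb K hK l c f hf

lemma claimB {Φ : Set E → ((E →ᵇ ℝ) →L[ℝ] ℝ)} (hΦ : IsCurv Φ) (e : E) (he : ‖e‖ = 1)
    (IH : ∀ Ψ : Set (ℝ ∙ e)ᗮ → (((ℝ ∙ e)ᗮ →ᵇ ℝ) →L[ℝ] ℝ), IsCurv Ψ → ∀ K, CB K → Ψ K = 0)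
    (K : Set (ℝ ∙ e)ᗮ) (hK : CB K) (r M : ℝ) (hr : 0 < r) (hrM : r < M) (g : E →ᵇ ℝ)
    (hg : UniformContinuous g) (hg0 : ∀ x, r ≤ |(inner ℝ e x : ℝ)| → g x = 0) :
    Φ (prism e K (-M) M) g = 0 := by
  set L := Φ (prism e K (-M) M) with hL
  have key : ∀ ε > 0, |L g| ≤ ‖L‖ * ε := by
    intro ε hε
    obtain ⟨ρ, hρ, hρg⟩ := Metric.uniformContinuous_iff.1 hg ε hε
    obtain ⟨N, hN⟩ := exists_nat_gt (2 * M / min (M - r) ρ)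
    have hm : 0 < min (M - r) ρ := lt_min (by linarith) hρ
    set δ : ℝ := 2 * M / (N + 1 : ℝ) with hδdef
    have hN1 : (0 : ℝ) < N + 1 := by positivity
    have hδ : 0 < δ := by apply div_pos <;> linarith
    have hδm : δ < min (M - r) ρ := by
      rw [hδdef, div_lt_iff₀ hN1]
      rw [div_lt_iff₀ hm] at hN
      nlinarith
    have hδ1 : δ < M - r := hδm.trans_le (min_le_left _ _)
    have hδ2 : δ < ρ := hδm.trans_le (min_le_right _ _)
    have hNδ : (N + 1 : ℝ) * δ = 2 * M := by rw [hδdef]; field_simp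
    let s : ℕ → ℝ := fun j => -M + j * δ
    have hs1 : ∀ j, s (j + 1) = s j + δ := by intro j; simp only [s]; push_cast; ring
    let sl : ℕ → ((ℝ ∙ e)ᗮ →ᵇ ℝ) := fun j =>
      g.compContinuous ⟨fun w => (w : E) + s (j + 1) • e, by fun_prop⟩
    let G : E →ᵇ ℝ := ∑ j ∈ Finset.range N, ten e (sl j) (eta δ (s j + δ) - eta δ (s j))
    have hG0 : L G = 0 := by
      simp only [G, map_sum]
      apply Finset.sum_eq_zero
      intro j hj
      have hjN : (j : ℝ) + 1 ≤ N := by exact_mod_cast Finset.mem_range.1 hj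
      have := IH _ (isCurv_prism hΦ e he (-M) M δ (s j) hδ
        (by simp only [s]; have : 0 ≤ (j : ℝ) * δ := by positivity
            linarith)
        (by simp only [s]; nlinarith)) K hK
      have h2 := DFunLike.congr_fun this (sl j)
      simpa [tenL_apply] using h2
    have hdiff : ‖g - G‖ ≤ ε := by
      refine (BoundedContinuousFunction.norm_le hε.le).2 fun x => ?_
      set t : ℝ := inner ℝ e x with ht
      let h : ℕ → ℝ := fun j => eta δ (s (j+1)) t - eta δ (s j) t
      have hh0 : ∀ j, 0 ≤ h j := fun j => by
        have := eta_mono δ (s j) (s (j+1)) t hδ (by rw [hs1]; linarith)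
        simp only [h]; linarith
      have hsum : ∑ j ∈ Finset.range N, h j = eta δ (s N) t - eta δ (s 0) t :=
        Finset.sum_range_sub (fun j => eta δ (s j) t) N
      have hs0 : s 0 = -M := by simp [s]
      have hsN : s N = M - δ := by simp only [s]; linarith
      have hgx : g x = (∑ j ∈ Finset.range N, h j) * g x := by
        by_cases hx : r ≤ |t|
        · rw [hg0 x hx]; simp
        · push Not at hx
          rw [abs_lt] at hx
          rw [hsum, hs0, hsN, eta_one δ _ _ hδ (by linarith), eta_zero δ _ _ hδ (by linarith)]
          ring
      have hGx : G x = ∑ j ∈ Finset.range N, h j * g ((pr e x : E) + s (j+1) • e) := by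
        simp only [G, BoundedContinuousFunction.sum_apply, ten_apply]
        apply Finset.sum_congr rfl
        intro j _
        simp only [h, hs1]
        rw [mul_comm]
        simp [sl, hs1, ht]
      have hbd : ∀ j, |h j * (g x - g ((pr e x : E) + s (j+1) • e))| ≤ h j * ε := by
        intro j
        rw [abs_mul, abs_of_nonneg (hh0 j)]
        by_cases hz : h j = 0
        · simp [hz]
        · apply mul_le_mul_of_nonneg_left _ (hh0 j)
          have h1 : s j ≤ t := by
            by_contra hc
            push Not at hc
            apply hz
            simp only [h]
            rw [eta_one δ _ _ hδ hc.le, eta_one δ _ _ hδ (by rw [hs1]; linarith)]; ring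
          have h2 : t ≤ s (j+1) + δ := by
            by_contra hc
            push Not at hc
            apply hz
            simp only [h]
            rw [eta_zero δ _ _ hδ hc.le, eta_zero δ _ _ hδ (by rw [hs1] at hc; linarith)]; ring
          have h3 : dist x ((pr e x : E) + s (j+1) • e) < ρ := by
            have : x - ((pr e x : E) + s (j+1) • e) = (t - s (j+1)) • e := by
              conv_lhs => rw [← pr_decomp e he x]
              rw [pr_shift e he, pr_W, ← ht]
              module
            rw [dist_eq_norm, this, norm_smul, he, mul_one, Real.norm_eq_abs, abs_lt]
            rw [hs1] at h2 ⊢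
            constructor <;> linarith
          have := hρg h3
          rw [Real.dist_eq] at this
          exact this.le
      have : (g - G) x = ∑ j ∈ Finset.range N, h j * (g x - g ((pr e x : E) + s (j+1) • e)) := by
        simp only [mul_sub]
        rw [Finset.sum_sub_distrib, ← Finset.sum_mul, ← hgx, ← hGx]
        rfl
      rw [this, Real.norm_eq_abs]
      calc _ ≤ ∑ j ∈ Finset.range N, |h j * (g x - g ((pr e x : E) + s (j+1) • e))| :=
            Finset.abs_sum_le_sum_abs _ _
        _ ≤ ∑ j ∈ Finset.range N, h j * ε := Finset.sum_le_sum fun j _ => hbd j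
        _ = (eta δ (s N) t - eta δ (s 0) t) * ε := by rw [← Finset.sum_mul, hsum]
        _ ≤ 1 * ε := by
          apply mul_le_mul_of_nonneg_right _ hε.le
          linarith [eta_le_one δ (s N) t, eta_nonneg δ (s 0) t]
        _ = ε := one_mul _
    have : L g = L (g - G) := by rw [map_sub, hG0, sub_zero]
    rw [this, ← Real.norm_eq_abs]
    exact (L.le_opNorm _).trans (mul_le_mul_of_nonneg_left hdiff (norm_nonneg _))
  by_contra hne
  have h0 : 0 < |L g| := abs_pos.2 hne
  have h1 := key (|L g| / (2 * (‖L‖ + 1))) (by positivity)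
  have h2 : ‖L‖ * (|L g| / (2 * (‖L‖ + 1))) < |L g| := by
    rw [← mul_div_assoc, div_lt_iff₀ (by positivity)]
    nlinarith [norm_nonneg L]
  linarith

lemma lemC {Φ : Set E → ((E →ᵇ ℝ) →L[ℝ] ℝ)} (hΦ : IsCurv Φ) (K : Set E) (hK : CB K) (f : E →ᵇ ℝ)
    (h : ∀ x ∈ K, f x ≠ 0 → ∃ U : Set E, IsOpen U ∧ x ∈ U ∧
      ∀ g : E →ᵇ ℝ, (∀ y, y ∉ U → g y = 0) → Φ K g = 0) : Φ K f = 0 := by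
  set L := Φ K with hL
  have key : ∀ ε > 0, |L f| ≤ ‖L‖ * ε := by
    intro ε hε
    let cl : E →ᵇ ℝ := BoundedContinuousFunction.ofNormedAddCommGroup
      (fun x => max (-ε) (min ε (f x))) (by fun_prop) ε (by
        intro x
        rw [Real.norm_eq_abs, abs_le]
        exact ⟨le_max_left _ _, max_le (by linarith) (min_le_left _ _)⟩)
    have hcl : ∀ x, cl x = max (-ε) (min ε (f x)) := fun x => rfl
    have hclε : ‖cl‖ ≤ ε := BoundedContinuousFunction.norm_ofNormedAddCommGroup_le _ hε.le _
    let Kε : Set E := K ∩ {x | ε ≤ |f x|}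
    have hcont : Continuous fun x => |f x| := by fun_prop
    have hKε : IsCompact Kε := hK.2.1.inter_right (isClosed_le continuous_const hcont)
    have hne : ∀ x : Kε, f x ≠ 0 := by
      rintro ⟨x, hx1, hx2⟩ h0
      simp only [Set.mem_ofPred_eq] at hx2
      simp only at h0
      rw [h0] at hx2; simp at hx2; linarith
    choose U hUo hxU hU using fun x : Kε => h x x.2.1 (hne x)
    obtain ⟨T, hT⟩ := hKε.elim_finite_subcover U hUo
      (fun x hx => Set.mem_iUnion.2 ⟨⟨x, hx⟩, hxU ⟨x, hx⟩⟩)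
    obtain ⟨ρ, hρ⟩ := PartitionOfUnity.exists_isSubordinate hKε.isClosed (fun i : T => U i)
      (fun i => hUo i) (by
        intro x hx
        obtain ⟨i, hi, hxi⟩ := Set.mem_iUnion₂.1 (hT hx)
        exact Set.mem_iUnion.2 ⟨⟨i, hi⟩, hxi⟩)
    let ρb : T → (E →ᵇ ℝ) := fun i => BoundedContinuousFunction.ofNormedAddCommGroup
      (fun x => ρ i x) (ρ i).continuous 1 (by
        intro x; rw [Real.norm_eq_abs, abs_of_nonneg (ρ.nonneg i x)]; exact ρ.le_one i x)
    have hρb : ∀ i x, ρb i x = ρ i x := fun i x => rfl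
    have h1 : L (f - cl) = L (∑ i, ρb i * (f - cl)) := by
      apply hΦ.congr hK
      intro x hx
      rw [BoundedContinuousFunction.sum_apply]
      simp only [BoundedContinuousFunction.mul_apply, hρb]
      rw [← Finset.sum_mul]
      by_cases hxε : ε ≤ |f x|
      · have := ρ.sum_eq_one (x := x) ⟨hx, hxε⟩
        rw [finsum_eq_sum_of_fintype] at this
        rw [this, one_mul]
      · push Not at hxε
        rw [abs_lt] at hxε
        have : (f - cl) x = 0 := by
          rw [BoundedContinuousFunction.sub_apply, hcl, min_eq_right hxε.2.le,
            max_eq_right hxε.1.le, sub_self]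
        rw [this, mul_zero]
    have h2 : L (∑ i, ρb i * (f - cl)) = 0 := by
      rw [map_sum]
      apply Finset.sum_eq_zero
      intro i _
      apply hU i
      intro y hy
      have : ρ i y = 0 := by
        by_contra hc
        exact hy (hρ i (subset_tsupport _ hc))
      rw [BoundedContinuousFunction.mul_apply, hρb, this, zero_mul]
    have h3 : L f = L cl := by
      rw [h2, map_sub] at h1; linarith
    rw [h3, ← Real.norm_eq_abs]
    exact (L.le_opNorm _).trans (mul_le_mul_of_nonneg_left hclε (norm_nonneg _))
  by_contra hne
  have h0 : 0 < |L f| := abs_pos.2 hne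
  have h1 := key (|L f| / (2 * (‖L‖ + 1))) (by positivity)
  have h2 : ‖L‖ * (|L f| / (2 * (‖L‖ + 1))) < |L f| := by
    rw [← mul_div_assoc, div_lt_iff₀ (by positivity)]
    nlinarith [norm_nonneg L]
  linarith

lemma lemD1 [FiniteDimensional ℝ E] {Φ : Set E → ((E →ᵇ ℝ) →L[ℝ] ℝ)} (hΦ : IsCurv Φ)
    (e : E) (he : ‖e‖ = 1)
    (IH : ∀ Ψ : Set (ℝ ∙ e)ᗮ → (((ℝ ∙ e)ᗮ →ᵇ ℝ) →L[ℝ] ℝ), IsCurv Ψ → ∀ K, CB K → Ψ K = 0)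
    (P : Set E) (hP : CB P) (x : E) (r : ℝ) (hr : 0 < r) (A : Set (E →L[ℝ] ℝ))
    (hA : ∀ y ∈ ball x r, y ∈ P ↔ ∀ a ∈ A, a (y - x) ≤ 0) (hAe : ∀ a ∈ A, a e = 0)
    (g : E →ᵇ ℝ) (hg : ∀ y, y ∉ ball x r → g y = 0) : Φ P g = 0 := by
  let K : Set (ℝ ∙ e)ᗮ := {w | ∀ a ∈ A, a (w : E) ≤ 0} ∩ closedBall 0 r
  have hset : {w : (ℝ ∙ e)ᗮ | ∀ a ∈ A, a (w : E) ≤ 0} =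
      ⋂ a ∈ A, {w : (ℝ ∙ e)ᗮ | a (w : E) ≤ 0} := by ext; simp
  have hK : CB K := by
    refine ⟨⟨0, ⟨fun a _ => by simp, by simp [hr.le]⟩⟩, ?_, ?_⟩
    · apply (isCompact_closedBall (0 : (ℝ ∙ e)ᗮ) r).inter_left
      rw [hset]
      exact isClosed_biInter fun a _ => isClosed_le (by fun_prop) continuous_const
    · apply Convex.inter _ (convex_closedBall _ _)
      rw [hset]
      exact convex_iInter₂ fun a _ =>
        (convex_Iic (0:ℝ)).linear_preimage ((a : E →ₗ[ℝ] ℝ).comp (ℝ ∙ e)ᗮ.subtype)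
  have hQ : CB (prism e K (-(2*r)) (2*r)) := prism_CB e he K hK _ _ (by linarith)
  have hQx : CB ((fun y => y + x) '' prism e K (-(2*r)) (2*r)) := by
    refine ⟨hQ.1.image _, hQ.2.1.image (by fun_prop), ?_⟩
    have := hQ.2.2.translate x
    have h2 : (fun z => x + z) = fun y : E => y + x := by funext y; exact add_comm _ _
    rwa [h2] at this
  have hin : ∀ z : E, |(inner ℝ e z : ℝ)| ≤ ‖z‖ := fun z => by
    simpa [he] using abs_real_inner_le_norm e z
  let g' : E →ᵇ ℝ := g.compContinuous ⟨fun y => y + x, by fun_prop⟩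
  rw [hΦ.loc P _ (ball x r) hP hQx isOpen_ball _ g hg, hΦ.trans _ hQ x g g' (fun y => rfl)]
  · have hg'0 : ∀ z, r ≤ ‖z‖ → g' z = 0 := by
      intro z hz
      apply hg
      simp [hz]
    apply claimB hΦ e he IH K hK r (2*r) hr (by linarith) g'
    · apply HasCompactSupport.uniformContinuous_of_continuous _ g'.continuous
      apply HasCompactSupport.intro (isCompact_closedBall (0:E) r)
      intro z hz
      apply hg'0
      simp at hz; exact hz.le
    · intro z hz
      exact hg'0 z (hz.trans (hin z))
  · ext y
    simp only [Set.mem_inter_iff]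
    apply and_congr_left
    intro hy
    rw [hA y hy]
    have hyx : ‖y - x‖ < r := by simpa [dist_eq_norm] using hy
    have hpr : ∀ a ∈ A, a ((pr e (y - x) : (ℝ ∙ e)ᗮ) : E) = a (y - x) := by
      intro a ha
      conv_rhs => rw [← pr_decomp e he (y - x)]
      rw [map_add, map_smul, hAe a ha]; simp
    have hn : ‖pr e (y - x)‖ ≤ ‖y - x‖ := Submodule.norm_orthogonalProjectionOnto_apply_le _ _
    constructor
    · intro h
      refine ⟨y - x, ⟨⟨?_, ?_⟩, ?_⟩, by simp⟩
      · intro a ha; rw [hpr a ha]; exact h a ha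
      · rw [mem_closedBall_zero_iff]; linarith
      · have := abs_le.1 (hin (y - x))
        constructor <;> linarith [this.1, this.2]
    · rintro ⟨z, ⟨⟨h1, h2⟩, h3⟩, hz⟩ a ha
      have : z = y - x := by rw [← hz]; simp
      subst this
      rw [← hpr a ha]; exact h1 a ha

/-- induction hypothesis -/
def IHn (n : ℕ) : Prop := ∀ (F : Type u) [NormedAddCommGroup F] [InnerProductSpace ℝ F]
  [FiniteDimensional ℝ F], Module.finrank ℝ F = n → ∀ Ψ : Set F → ((F →ᵇ ℝ) →L[ℝ] ℝ), IsCurv Ψ →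
  ∀ K, CB K → Ψ K = 0

lemma lemD [FiniteDimensional ℝ E] {Φ : Set E → ((E →ᵇ ℝ) →L[ℝ] ℝ)} (hΦ : IsCurv Φ) (n : ℕ)
    (hn : Module.finrank ℝ E = n + 1) (IH : IHn.{u} n)
    (P : Set E) (hP : CB P) (x : E) (r : ℝ) (hr : 0 < r) (A : Set (E →L[ℝ] ℝ))
    (hA : ∀ y ∈ ball x r, y ∈ P ↔ ∀ a ∈ A, a (y - x) ≤ 0)
    (e : E) (he : e ≠ 0) (hAe : ∀ a ∈ A, a e = 0)
    (g : E →ᵇ ℝ) (hg : ∀ y, y ∉ ball x r → g y = 0) : Φ P g = 0 := by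
  have he1 : ‖(‖e‖⁻¹ • e)‖ = 1 := norm_smul_inv_norm (𝕜 := ℝ) he
  have he0 : (‖e‖⁻¹ • e) ≠ 0 := by rw [← norm_ne_zero_iff, he1]; exact one_ne_zero
  have : Fact (Module.finrank ℝ E = n + 1) := ⟨hn⟩
  exact lemD1 hΦ (‖e‖⁻¹ • e) he1
    (IH _ (Submodule.finrank_orthogonal_span_singleton (n := n) he0)) P hP x r hr A hA
    (fun a ha => by rw [map_smul, hAe a ha, smul_zero]) g hg

def poly (A : Set ((E →L[ℝ] ℝ) × ℝ)) : Set E := {y | ∀ p ∈ A, p.1 y ≤ p.2}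

lemma poly_closed (A : Set ((E →L[ℝ] ℝ) × ℝ)) : IsClosed (poly A) := by
  have : poly A = ⋂ p ∈ A, {y : E | p.1 y ≤ p.2} := by ext; simp [poly]
  rw [this]
  exact isClosed_biInter fun p _ => isClosed_le p.1.continuous continuous_const

lemma poly_convex (A : Set ((E →L[ℝ] ℝ) × ℝ)) : Convex ℝ (poly A) := by
  have : poly A = ⋂ p ∈ A, {y : E | p.1 y ≤ p.2} := by ext; simp [poly]
  rw [this]
  exact convex_iInter₂ fun p _ => (convex_Iic p.2).linear_preimage (p.1 : E →ₗ[ℝ] ℝ)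

lemma lemE (A : Set ((E →L[ℝ] ℝ) × ℝ)) (hA : A.Finite) (x : E) (hx : x ∈ poly A) :
    ∃ r > 0, ∀ y ∈ ball x r, y ∈ poly A ↔ ∀ a ∈ {a : E →L[ℝ] ℝ | (a, a x) ∈ A}, a (y - x) ≤ 0 := by
  have h1 : ∀ᶠ y in 𝓝 x, ∀ p ∈ A, p.1 x < p.2 → p.1 y < p.2 := by
    rw [Filter.eventually_all_finite hA]
    intro p hp
    by_cases h : p.1 x < p.2
    · have := p.1.continuous.continuousAt.eventually_lt (continuousAt_const (y := p.2)) h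
      filter_upwards [this] with y hy _ using hy
    · exact Filter.Eventually.of_forall fun y h' => absurd h' h
  obtain ⟨r, hr, h⟩ := Metric.eventually_nhds_iff_ball.1 h1
  refine ⟨r, hr, fun y hy => ⟨?_, ?_⟩⟩
  · intro hyP a ha
    have := hyP _ ha
    simp only at this
    rw [map_sub]; linarith
  · intro hya p hp
    rcases (hx p hp).lt_or_eq with h2 | h2
    · exact (h y hy p hp h2).le
    · have := hya p.1 (show (p.1, p.1 x) ∈ A by rw [h2]; exact hp)
      rw [map_sub] at this; linarith

def tip (B : Finset (E →L[ℝ] ℝ)) : Set ((E →L[ℝ] ℝ) × ℝ) :=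
  insert (-∑ a ∈ B, a, 1) ((fun a => (a, (0:ℝ))) '' (B : Set (E →L[ℝ] ℝ)))

lemma mem_tip (B : Finset (E →L[ℝ] ℝ)) (y : E) :
    y ∈ poly (tip B) ↔ (0 ≤ 1 + ∑ a ∈ B, a y) ∧ ∀ a ∈ B, a y ≤ 0 := by
  have h : y ∈ poly (tip B) ↔ (-∑ a ∈ B, a) y ≤ 1 ∧ ∀ a ∈ B, a y ≤ 0 := by
    simp [poly, tip]
  rw [h]
  apply and_congr_left
  intro _
  simp only [neg_apply, sum_apply]
  constructor <;> intro <;> linarith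

lemma tip_CB [FiniteDimensional ℝ E] (B : Finset (E →L[ℝ] ℝ))
    (hB : ∀ y : E, (∀ a ∈ B, a y = 0) → y = 0) : CB (poly (tip B)) := by
  refine ⟨⟨0, by simp [mem_tip]⟩, ?_, poly_convex _⟩
  apply Metric.isCompact_of_isClosed_isBounded (poly_closed _)
  let T : E →ₗ[ℝ] (B → ℝ) := LinearMap.pi fun a => (a.1 : E →ₗ[ℝ] ℝ)
  have hT : LinearMap.ker T = ⊥ := by
    rw [LinearMap.ker_eq_bot']
    intro y hy
    apply hB
    intro a ha
    exact congrFun hy ⟨a, ha⟩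
  obtain ⟨C, _, hC⟩ := T.exists_antilipschitzWith hT
  rw [isBounded_iff_forall_norm_le]
  refine ⟨C * 1, fun y hy => ?_⟩
  rw [mem_tip] at hy
  have h1 := hC.le_mul_dist y 0
  rw [map_zero, dist_zero_right, dist_zero_right] at h1
  refine h1.trans (mul_le_mul_of_nonneg_left ?_ C.2)
  rw [pi_norm_le_iff_of_nonneg zero_le_one]
  rintro ⟨a, ha⟩
  change ‖a y‖ ≤ 1
  rw [Real.norm_eq_abs, abs_of_nonpos (hy.2 a ha)]
  have : ∑ b ∈ B, a y ≤ 0 := by apply Finset.sum_nonpos; intro b _; exact hy.2 a ha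
  have h2 : -a y ≤ ∑ b ∈ B, -(b y) :=
    Finset.single_le_sum (f := fun b : E →L[ℝ] ℝ => -(b y))
      (fun b hb => by have := hy.2 b hb; linarith) ha
  rw [Finset.sum_neg_distrib] at h2
  linarith [hy.1]

lemma lemF [FiniteDimensional ℝ E] {Φ : Set E → ((E →ᵇ ℝ) →L[ℝ] ℝ)} (hΦ : IsCurv Φ) (n : ℕ)
    (hn : Module.finrank ℝ E = n + 1) (IH : IHn.{u} n) (B : Finset (E →L[ℝ] ℝ))
    (hB : ∀ y : E, (∀ a ∈ B, a y = 0) → y = 0) (g : E →ᵇ ℝ)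
    (hg : ∀ y, 1 + ∑ a ∈ B, a y = 0 → g y = 0) : Φ (poly (tip B)) g = 0 := by
  have hS := tip_CB B hB
  let αb : E →ᵇ ℝ := BoundedContinuousFunction.ofNormedAddCommGroup
    (fun y => max 0 (min 1 (1 + ∑ a ∈ B, a y))) (by fun_prop) 1 (by
      intro x
      rw [Real.norm_eq_abs, abs_of_nonneg (le_max_left _ _)]
      exact max_le zero_le_one (min_le_left _ _))
  have hα : ∀ y, αb y = max 0 (min 1 (1 + ∑ a ∈ B, a y)) := fun y => rfl
  have h1 : Φ (poly (tip B)) αb = 0 := by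
    apply hΦ.aff _ hS (∑ a ∈ B, a) 1
    intro x hx
    rw [mem_tip] at hx
    have h2 : ∑ a ∈ B, a x ≤ 0 := Finset.sum_nonpos hx.2
    rw [hα, min_eq_right (by linarith), max_eq_right hx.1, sum_apply]
    ring
  have h2 : Φ (poly (tip B)) (g - g 0 • αb) = 0 := by
    apply lemC hΦ _ hS
    intro x hx hfx
    have hx0 : x ≠ 0 := by
      rintro rfl
      apply hfx
      simp [hα]
    have hαx : 1 + ∑ a ∈ B, a x ≠ 0 := by
      intro h0
      apply hfx
      simp [hα, hg x h0, h0]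
    obtain ⟨r, hr, hrx⟩ := lemE (tip B) (by
      apply Set.Finite.insert; exact (B.finite_toSet).image _) x hx
    refine ⟨ball x r, isOpen_ball, mem_ball_self hr, fun g' hg' => ?_⟩
    apply lemD hΦ n hn IH _ hS x r hr _ hrx x hx0 _ g' hg'
    rintro a (ha | ⟨b, hb, hab⟩)
    · exfalso
      apply hαx
      have h3 := congrArg Prod.fst ha
      have h4 := congrArg Prod.snd ha
      simp only at h3 h4
      rw [h3] at h4
      simp only [neg_apply, sum_apply] at h4
      linarith
    · have h4 := congrArg Prod.snd hab
      exact h4.symm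
  rw [map_sub, map_smul, h1] at h2
  simpa using h2

lemma poly_zero [FiniteDimensional ℝ E] {Φ : Set E → ((E →ᵇ ℝ) →L[ℝ] ℝ)} (hΦ : IsCurv Φ) (n : ℕ)
    (hn : Module.finrank ℝ E = n + 1) (IH : IHn.{u} n) (A : Set ((E →L[ℝ] ℝ) × ℝ)) (hA : A.Finite)
    (hP : CB (poly A)) (f : E →ᵇ ℝ) : Φ (poly A) f = 0 := by
  apply lemC hΦ _ hP
  intro x hx _
  obtain ⟨r, hr, hrx⟩ := lemE A hA x hx
  by_cases hex : ∃ e : E, e ≠ 0 ∧ ∀ a ∈ {a : E →L[ℝ] ℝ | (a, a x) ∈ A}, a e = 0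
  · obtain ⟨e, he, hae⟩ := hex
    exact ⟨ball x r, isOpen_ball, mem_ball_self hr,
      fun g hg => lemD hΦ n hn IH _ hP x r hr _ hrx e he hae g hg⟩
  · push Not at hex
    have hfin : {a : E →L[ℝ] ℝ | (a, a x) ∈ A}.Finite := by
      apply (hA.image Prod.fst).subset
      intro a ha
      exact ⟨_, ha, rfl⟩
    set B := hfin.toFinset with hBdef
    have hBm : ∀ a, a ∈ B ↔ a ∈ {a : E →L[ℝ] ℝ | (a, a x) ∈ A} := fun a => hfin.mem_toFinset
    have hB : ∀ y : E, (∀ a ∈ B, a y = 0) → y = 0 := by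
      intro y hy
      by_contra hy0
      obtain ⟨a, ha, hay⟩ := hex y hy0
      exact hay (hy a ((hBm a).2 ha))
    let U : Set E := ball x r ∩ {y | 0 < 1 + ∑ a ∈ B, a (y - x)}
    have hU : IsOpen U := isOpen_ball.inter (isOpen_lt continuous_const (by fun_prop))
    refine ⟨U, hU, ⟨mem_ball_self hr, by simp⟩, fun g hg => ?_⟩
    have hS := tip_CB B hB
    have hSx : CB ((fun y => y + x) '' poly (tip B)) := by
      refine ⟨hS.1.image _, hS.2.1.image (by fun_prop), ?_⟩
      have := hS.2.2.translate x
      have h2 : (fun z => x + z) = fun y : E => y + x := by funext y; exact add_comm _ _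
      rwa [h2] at this
    let g' : E →ᵇ ℝ := g.compContinuous ⟨fun y => y + x, by fun_prop⟩
    rw [hΦ.loc _ _ U hP hSx hU _ g hg, hΦ.trans _ hS x g g' (fun y => rfl)]
    · apply lemF hΦ n hn IH B hB
      intro y hy
      apply hg
      rintro ⟨_, h2⟩
      have h3 : 0 < 1 + ∑ a ∈ B, a ((y + x) - x) := h2
      rw [add_sub_cancel_right] at h3
      linarith
    · ext y
      simp only [Set.mem_inter_iff]
      apply and_congr_left
      rintro ⟨hy1, hy2⟩
      rw [hrx y hy1]
      constructor
      · intro h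
        refine ⟨y - x, (mem_tip _ _).2 ⟨le_of_lt hy2, fun a ha => h a ((hBm a).1 ha)⟩, by simp⟩
      · rintro ⟨z, hz, rfl⟩ a ha
        rw [add_sub_cancel_right]
        exact ((mem_tip _ _).1 hz).2 a ((hBm a).2 ha)

lemma approx [FiniteDimensional ℝ E] (K : Set E) (hK : CB K) (ε : ℝ) (hε : 0 < ε) :
    ∃ A : Set ((E →L[ℝ] ℝ) × ℝ), A.Finite ∧ CB (poly A) ∧ K ⊆ poly A ∧
      ∀ x ∈ poly A, ∃ y ∈ K, dist x y ≤ ε := by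
  have hcont : Continuous fun x : E => infDist x K := continuous_infDist_pt K
  have hbd : Bornology.IsBounded {x : E | infDist x K ≤ ε} := by
    obtain ⟨R, hR⟩ := isBounded_iff_forall_norm_le.1 hK.2.1.isBounded
    rw [isBounded_iff_forall_norm_le]
    refine ⟨R + ε, fun x hx => ?_⟩
    obtain ⟨y, hy, hxy⟩ := hK.2.1.exists_infDist_eq_dist hK.1 x
    have h1 : dist x y ≤ ε := by rw [← hxy]; exact hx
    rw [dist_eq_norm] at h1
    have h2 := hR y hy
    have h3 : ‖x‖ ≤ ‖x - y‖ + ‖y‖ := by simpa using norm_add_le (x - y) y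
    linarith
  let sh : Set E := {x | infDist x K = ε}
  have hsh : IsCompact sh := by
    apply Metric.isCompact_of_isClosed_isBounded (isClosed_eq hcont continuous_const)
    exact hbd.subset fun x hx => le_of_eq hx
  have hsep : ∀ x : sh, ∃ p : (E →L[ℝ] ℝ) × ℝ, (∀ y ∈ K, p.1 y < p.2) ∧ p.2 < p.1 x := by
    rintro ⟨x, hx⟩
    obtain ⟨f, u, h1, h2⟩ := geometric_hahn_banach_closed_point hK.2.2 hK.2.1.isClosed (x := x) (by
      intro hxK
      have h0 := infDist_zero_of_mem hxK
      have hx' : infDist x K = ε := hx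
      linarith)
    exact ⟨(f, u), h1, h2⟩
  choose p hp1 hp2 using hsep
  obtain ⟨T, hT⟩ := hsh.elim_finite_subcover (fun x : sh => {y : E | (p x).2 < (p x).1 y})
    (fun x => isOpen_lt continuous_const (p x).1.continuous)
    (fun x hx => Set.mem_iUnion.2 ⟨⟨x, hx⟩, hp2 ⟨x, hx⟩⟩)
  refine ⟨p '' T, T.finite_toSet.image _, ?_⟩
  have hKA : K ⊆ poly (p '' (T : Set sh)) := by
    rintro y hy _ ⟨x, _, rfl⟩
    exact (hp1 x y hy).le
  have hsub : ∀ x ∈ poly (p '' (T : Set sh)), infDist x K ≤ ε := by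
    intro x hx
    by_contra hc
    push Not at hc
    obtain ⟨k, hk⟩ := hK.1
    have hpc : IsPreconnected (poly (p '' (T : Set sh))) := (poly_convex _).isPreconnected
    have hiv := hpc.intermediate_value (hKA hk) hx hcont.continuousOn
    obtain ⟨z, hz, hz2⟩ := hiv (show ε ∈ Set.Icc (infDist k K) (infDist x K) by
      rw [infDist_zero_of_mem hk]; exact ⟨hε.le, hc.le⟩)
    obtain ⟨i, hi, hzi⟩ := Set.mem_iUnion₂.1 (hT (show z ∈ sh from hz2))
    exact absurd (hz (p i) ⟨i, hi, rfl⟩) (not_le.2 hzi)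
  refine ⟨⟨hK.1.mono hKA, ?_, poly_convex _⟩, hKA, ?_⟩
  · exact Metric.isCompact_of_isClosed_isBounded (poly_closed _) (hbd.subset hsub)
  · intro x hx
    obtain ⟨y, hy, hxy⟩ := hK.2.1.exists_infDist_eq_dist hK.1 x
    exact ⟨y, hy, by rw [← hxy]; exact hsub x hx⟩

theorem IHn_all (n : ℕ) : IHn.{u} n := by
  induction n with
  | zero =>
    intro F _ _ _ hF Ψ hΨ K hK
    have : Subsingleton F := Module.finrank_zero_iff.1 hF
    ext f
    apply hΨ.aff K hK 0 (f 0)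
    intro x _
    rw [Subsingleton.elim x 0]; simp
  | succ n IH =>
    intro F _ _ _ hF Ψ hΨ K hK
    ext f
    choose A hA1 hA2 hA3 hA4 using fun i : ℕ => approx K hK (1 / ((i : ℝ) + 1)) (by positivity)
    have h := hΨ.cont (fun i => poly (A i)) K hA2 hK hA3 (fun i => 1 / ((i : ℝ) + 1))
      tendsto_one_div_add_atTop_nhds_zero_nat hA4 f
    simp only [poly_zero hΨ n hF IH _ (hA1 _) (hA2 _)] at h
    exact tendsto_nhds_unique h tendsto_const_nhds

end Abs

section Final

variable {n : ℕ}

lemma sm_apply (s : SignedMeasure (Rn n)) (β : Set (Rn n)) (hβ : MeasurableSet β) :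
    s β = s.toJordanDecomposition.posPart.real β - s.toJordanDecomposition.negPart.real β :=
  s.apply_eq_posPart_real_sub_negPart_real hβ

noncomputable def sI (s : SignedMeasure (Rn n)) : (Rn n →ᵇ ℝ) →L[ℝ] ℝ :=
  LinearMap.mkContinuous
    { toFun := fun f => (∫ x, f x ∂s.toJordanDecomposition.posPart)
        - ∫ x, f x ∂s.toJordanDecomposition.negPart
      map_add' := fun f g => by
        simp only [BoundedContinuousFunction.add_apply]
        rw [integral_add (f.integrable _) (g.integrable _),
          integral_add (f.integrable _) (g.integrable _)]
        ring
      map_smul' := fun c f => by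
        simp only [BoundedContinuousFunction.smul_apply, smul_eq_mul, RingHom.id_apply]
        rw [integral_const_mul, integral_const_mul]; ring }
    (s.toJordanDecomposition.posPart.real Set.univ + s.toJordanDecomposition.negPart.real Set.univ)
    (by
      intro f
      have h1 := f.norm_integral_le_mul_norm s.toJordanDecomposition.posPart
      have h2 := f.norm_integral_le_mul_norm s.toJordanDecomposition.negPart
      refine (norm_sub_le _ _).trans ?_
      rw [add_mul]
      exact add_le_add h1 h2)

lemma sI_apply (s : SignedMeasure (Rn n)) (f : Rn n →ᵇ ℝ) :
    sI s f = (∫ x, f x ∂s.toJordanDecomposition.posPart)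
        - ∫ x, f x ∂s.toJordanDecomposition.negPart := rfl

lemma sI_local (s t : SignedMeasure (Rn n)) (U : Set (Rn n)) (hU : MeasurableSet U)
    (h : ∀ β, MeasurableSet β → β ⊆ U → s β = t β) (f : Rn n →ᵇ ℝ) (hf : ∀ x, x ∉ U → f x = 0) :
    sI s f = sI t f := by
  rw [sI_apply, sI_apply]
  rw [← setIntegral_eq_integral_of_forall_compl_eq_zero (s := U)
      (μ := s.toJordanDecomposition.posPart) hf,
    ← setIntegral_eq_integral_of_forall_compl_eq_zero (s := U)
      (μ := s.toJordanDecomposition.negPart) hf,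
    ← setIntegral_eq_integral_of_forall_compl_eq_zero (s := U)
      (μ := t.toJordanDecomposition.posPart) hf,
    ← setIntegral_eq_integral_of_forall_compl_eq_zero (s := U)
      (μ := t.toJordanDecomposition.negPart) hf]
  have hm : s.toJordanDecomposition.posPart.restrict U + t.toJordanDecomposition.negPart.restrict U
      = t.toJordanDecomposition.posPart.restrict U
        + s.toJordanDecomposition.negPart.restrict U := by
    ext β hβ
    have h1 := h (β ∩ U) (hβ.inter hU) Set.inter_subset_right
    rw [sm_apply _ _ (hβ.inter hU), sm_apply _ _ (hβ.inter hU)] at h1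
    simp only [Measure.add_apply, Measure.restrict_apply hβ]
    rw [← ENNReal.toReal_eq_toReal_iff' (by finiteness) (by finiteness),
      ENNReal.toReal_add (by finiteness) (by finiteness),
      ENNReal.toReal_add (by finiteness) (by finiteness)]
    simp only [measureReal_def] at h1
    linarith
  have := congrArg (fun μ : Measure (Rn n) => ∫ x, f x ∂μ) hm
  beta_reduce at this
  rw [integral_add_measure (f.integrable _) (f.integrable _),
    integral_add_measure (f.integrable _) (f.integrable _)] at this
  linarith

lemma sI_trans (s t : SignedMeasure (Rn n)) (x : Rn n)
    (h : ∀ β, MeasurableSet β → t β = s ((fun y => y + x) ⁻¹' β)) (f g : Rn n →ᵇ ℝ)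
    (hfg : ∀ y, g y = f (y + x)) :
    sI t f = sI s g := by
  have hmx : Measurable (fun y : Rn n => y + x) := by fun_prop
  rw [sI_apply, sI_apply]
  simp only [hfg]
  rw [← integral_map (f := f) hmx.aemeasurable f.continuous.aestronglyMeasurable,
    ← integral_map (f := f) hmx.aemeasurable f.continuous.aestronglyMeasurable]
  have hm : t.toJordanDecomposition.posPart + (s.toJordanDecomposition.negPart.map fun y => y + x)
      = (s.toJordanDecomposition.posPart.map fun y => y + x)
        + t.toJordanDecomposition.negPart := by
    ext β hβ
    have h1 := h β hβ
    rw [sm_apply _ _ hβ, sm_apply _ _ (hmx hβ)] at h1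
    simp only [Measure.add_apply, Measure.map_apply hmx hβ]
    rw [← ENNReal.toReal_eq_toReal_iff' (by finiteness) (by finiteness),
      ENNReal.toReal_add (by finiteness) (by finiteness),
      ENNReal.toReal_add (by finiteness) (by finiteness)]
    simp only [measureReal_def] at h1
    linarith
  have := congrArg (fun μ : Measure (Rn n) => ∫ x, f x ∂μ) hm
  beta_reduce at this
  rw [integral_add_measure (f.integrable _) (f.integrable _),
    integral_add_measure (f.integrable _) (f.integrable _)] at this
  linarith

lemma jordan_null (s : SignedMeasure (Rn n)) (V : Set (Rn n)) (hV : MeasurableSet V)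
    (h : ∀ β, MeasurableSet β → β ⊆ V → s β = 0) :
    s.toJordanDecomposition.posPart V = 0 ∧ s.toJordanDecomposition.negPart V = 0 := by
  obtain ⟨N, hN, h1, h2⟩ := s.toJordanDecomposition.mutuallySingular
  constructor
  · have h3 := h (V ∩ Nᶜ) (hV.inter hN.compl) Set.inter_subset_left
    rw [sm_apply _ _ (hV.inter hN.compl)] at h3
    have h4 : s.toJordanDecomposition.negPart (V ∩ Nᶜ) = 0 :=
      measure_mono_null Set.inter_subset_right h2
    have h5 : s.toJordanDecomposition.posPart (V ∩ Nᶜ) = 0 := by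
      simp only [measureReal_def, h4, ENNReal.toReal_zero, sub_zero] at h3
      exact ((ENNReal.toReal_eq_zero_iff _).1 h3).resolve_right (by finiteness)
    apply measure_mono_null (t := (V ∩ Nᶜ) ∪ N) _ (measure_union_null h5 h1)
    intro x hx; by_cases hxN : x ∈ N
    · exact Or.inr hxN
    · exact Or.inl ⟨hx, hxN⟩
  · have h3 := h (V ∩ N) (hV.inter hN) Set.inter_subset_left
    rw [sm_apply _ _ (hV.inter hN)] at h3
    have h4 : s.toJordanDecomposition.posPart (V ∩ N) = 0 :=
      measure_mono_null Set.inter_subset_right h1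
    have h5 : s.toJordanDecomposition.negPart (V ∩ N) = 0 := by
      simp only [measureReal_def, h4, ENNReal.toReal_zero, zero_sub, neg_eq_zero] at h3
      exact ((ENNReal.toReal_eq_zero_iff _).1 h3).resolve_right (by finiteness)
    apply measure_mono_null (t := (V ∩ N) ∪ Nᶜ) _ (measure_union_null h5 h2)
    intro x hx; by_cases hxN : x ∈ N
    · exact Or.inl ⟨hx, hxN⟩
    · exact Or.inr hxN

lemma CB_translate (K : Set (Rn n)) (hK : CB K) (x : Rn n) : CB ((fun y => y + x) '' K) := by
  refine ⟨hK.1.image _, hK.2.1.image (by fun_prop), ?_⟩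
  have := hK.2.2.translate x
  have h2 : (fun z => x + z) = fun y : Rn n => y + x := by funext y; exact add_comm _ _
  rwa [h2] at this

lemma supp_ball (M : Set (Rn n) → SignedMeasure (Rn n))
    (loc : ∀ K L U : Set (Rn n), CB K → CB L → IsOpen U →
      K ∩ U = L ∩ U → ∀ β : Set (Rn n), MeasurableSet β → β ⊆ U → M K β = M L β)
    (tr : ∀ K : Set (Rn n), CB K → ∀ x : Rn n, ∀ β : Set (Rn n), MeasurableSet β →
      M ((fun y => y + x) '' K) β = M K ((fun y => y + x) ⁻¹' β))
    (K : Set (Rn n)) (hK : CB K) (x : Rn n) (r : ℝ) (hr : 0 < r) (hx : ∀ y ∈ ball x r, y ∉ K)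
    (β : Set (Rn n)) (hβ : MeasurableSet β) (hβx : β ⊆ ball x r) : M K β = 0 := by
  obtain ⟨k, hk⟩ := hK.1
  have hxk : x - k ≠ 0 := by
    intro h0
    rw [sub_eq_zero] at h0
    exact hx x (mem_ball_self hr) (h0 ▸ hk)
  obtain ⟨D, hD⟩ := hK.2.1.isBounded.subset_closedBall x
  have hD0 : 0 ≤ D := dist_nonneg.trans (hD hk)
  have hnk : 0 < ‖x - k‖ := norm_pos_iff.2 hxk
  let w : Rn n := ((2 * (D + r)) / ‖x - k‖) • (x - k)
  have hw : ‖w‖ = 2 * (D + r) := by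
    simp only [w]
    rw [norm_smul, Real.norm_eq_abs, abs_of_nonneg (by positivity)]
    field_simp
  let y : ℕ → Rn n := fun j => ((j : ℝ) + 1) • w
  have hy : ∀ j, 2 * (D + r) ≤ ‖y j‖ := by
    intro j
    simp only [y]
    rw [norm_smul, hw, Real.norm_eq_abs, abs_of_nonneg (by positivity)]
    have : 0 ≤ (j : ℝ) * (D + r) := by positivity
    nlinarith
  have hyy : ∀ i j, i ≠ j → 2 * (D + r) ≤ ‖y i - y j‖ := by
    intro i j hij
    have : y i - y j = ((i : ℝ) - j) • w := by simp only [y]; module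
    rw [this, norm_smul, hw, Real.norm_eq_abs]
    have h1 : (1 : ℝ) ≤ |(i : ℝ) - j| := by
      have : (1 : ℤ) ≤ |(i : ℤ) - j| := Int.one_le_abs (by omega)
      exact_mod_cast this
    nlinarith
  let b : ℕ → Set (Rn n) := fun j => (fun z => z + y j) ⁻¹' β
  have hb : ∀ j, MeasurableSet (b j) := fun j => by
    have : Measurable (fun z : Rn n => z + y j) := by fun_prop
    exact this hβ
  have hval : ∀ j, M K (b j) = M K β := by
    intro j
    rw [← tr K hK (y j) β hβ]
    apply loc _ _ (ball x r) (CB_translate K hK _) hK isOpen_ball _ β hβ hβx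
    have e1 : K ∩ ball x r = ∅ := by
      ext z; simp only [Set.mem_inter_iff, Set.mem_empty_iff_false, iff_false, not_and]
      exact fun h1 h2 => hx z h2 h1
    rw [e1]
    ext z; simp only [Set.mem_inter_iff, Set.mem_empty_iff_false, iff_false, not_and]
    rintro ⟨k', hk', rfl⟩ h2
    have h3 := hD hk'
    rw [mem_closedBall, dist_eq_norm] at h3
    rw [mem_ball, dist_eq_norm] at h2
    have h4 : ‖y j‖ ≤ ‖k' + y j - x‖ + ‖k' - x‖ := by
      have := norm_sub_le (k' + y j - x) (k' - x)
      have e : (k' + y j - x) - (k' - x) = y j := by abel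
      rwa [e] at this
    linarith [hy j]
  have hdisj : Pairwise (Function.onFun Disjoint b) := by
    intro i j hij
    rw [Function.onFun, Set.disjoint_left]
    intro z hz1 hz2
    have h1 := hβx hz1
    have h2 := hβx hz2
    rw [mem_ball, dist_eq_norm] at h1 h2
    have h4 : ‖y i - y j‖ ≤ ‖z + y i - x‖ + ‖z + y j - x‖ := by
      have := norm_sub_le (z + y i - x) (z + y j - x)
      have e : (z + y i - x) - (z + y j - x) = y i - y j := by abel
      rwa [e] at this
    linarith [hyy i j hij]
  have hs := (VectorMeasure.hasSum_of_disjoint_iUnion (v := M K) hb hdisj).summable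
  simp only [hval] at hs
  exact (summable_const_iff _).1 hs

lemma signed_main (M : Set (Rn n) → SignedMeasure (Rn n))
    (loc : ∀ K L U : Set (Rn n), CB K → CB L → IsOpen U →
      K ∩ U = L ∩ U → ∀ β : Set (Rn n), MeasurableSet β → β ⊆ U → M K β = M L β)
    (tr : ∀ K : Set (Rn n), CB K → ∀ x : Rn n, ∀ β : Set (Rn n), MeasurableSet β →
      M ((fun y => y + x) '' K) β = M K ((fun y => y + x) ⁻¹' β))
    (cont : ∀ (Ki : ℕ → Set (Rn n)) (K : Set (Rn n)), (∀ i, CB (Ki i)) →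
      CB K → Tendsto (fun i => hausdorffDist (Ki i) K) atTop (𝓝 0) →
      ∀ f : Rn n →ᵇ ℝ, Tendsto (fun i => sI (M (Ki i)) f) atTop (𝓝 (sI (M K) f)))
    (glob : ∀ K, CB K → M K Set.univ = 0)
    (coord : ∀ K, CB K → ∀ i : Fin n, (∫ x, x i ∂(M K).toJordanDecomposition.posPart)
      - (∫ x, x i ∂(M K).toJordanDecomposition.negPart) = 0) :
    ∀ K, CB K → M K = 0 := by
  have hnull : ∀ K, CB K → (M K).toJordanDecomposition.posPart Kᶜ = 0 ∧
      (M K).toJordanDecomposition.negPart Kᶜ = 0 := by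
    intro K hK
    have key : ∀ x ∈ Kᶜ, ∃ r > 0, (M K).toJordanDecomposition.posPart (ball x r) = 0 ∧
        (M K).toJordanDecomposition.negPart (ball x r) = 0 := by
      intro x hx
      obtain ⟨r, hr, hrK⟩ := Metric.isOpen_iff.1 hK.2.1.isClosed.isOpen_compl x hx
      exact ⟨r, hr, jordan_null _ _ measurableSet_ball fun β hβ hβx =>
        supp_ball M loc tr K hK x r hr (fun y hy => hrK hy) β hβ hβx⟩
    constructor
    · apply measure_null_of_locally_null
      intro x hx
      obtain ⟨r, hr, h1, h2⟩ := key x hx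
      exact ⟨ball x r, mem_nhdsWithin_of_mem_nhds (ball_mem_nhds x hr), h1⟩
    · apply measure_null_of_locally_null
      intro x hx
      obtain ⟨r, hr, h1, h2⟩ := key x hx
      exact ⟨ball x r, mem_nhdsWithin_of_mem_nhds (ball_mem_nhds x hr), h2⟩
  have hcurv : IsCurv (fun K => sI (M K)) := by
    constructor
    · intro K L U hK hL hU hKL f hf
      exact sI_local _ _ U hU.measurableSet (loc K L U hK hL hU hKL) f hf
    · intro K hK f hf
      have h1 : f =ᵐ[(M K).toJordanDecomposition.posPart] 0 := by
        filter_upwards [measure_eq_zero_iff_ae_notMem.1 (hnull K hK).1] with x hx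
        exact hf x (by simpa using hx)
      have h2 : f =ᵐ[(M K).toJordanDecomposition.negPart] 0 := by
        filter_upwards [measure_eq_zero_iff_ae_notMem.1 (hnull K hK).2] with x hx
        exact hf x (by simpa using hx)
      simp only [sI_apply]
      rw [integral_congr_ae h1, integral_congr_ae h2]
      simp
    · intro K hK x f g hfg
      exact sI_trans _ _ x (tr K hK x) f g hfg
    · intro Ki K hKi hK hsub ε hε hd f
      apply cont Ki K hKi hK _ f
      apply squeeze_zero (fun i => hausdorffDist_nonneg) _ hε
      intro i
      have hε0 : 0 ≤ ε i := by
        obtain ⟨z, hz⟩ := (hKi i).1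
        obtain ⟨y, _, hy⟩ := hd i z hz
        exact dist_nonneg.trans hy
      exact hausdorffDist_le_of_mem_dist hε0 (hd i)
        (fun x hx => ⟨x, hsub i hx, by simpa using hε0⟩)
    · intro K hK l c f hf
      obtain ⟨R, hR⟩ := isBounded_iff_forall_norm_le.1 hK.2.1.isBounded
      have hl : ∀ x : Rn n, l x = ∑ i, l (EuclideanSpace.single i 1) * x i := by
        intro x
        conv_lhs => rw [← (EuclideanSpace.basisFun (Fin n) ℝ).sum_repr x]
        simp [map_sum, mul_comm]
      have hint : ∀ (μ : Measure (Rn n)) [IsFiniteMeasure μ], μ Kᶜ = 0 →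
          ∫ x, f x ∂μ = (∑ i, l (EuclideanSpace.single i 1) * ∫ x, x i ∂μ) + c * μ.real Set.univ := by
        intro μ _ hμ
        have hae : ∀ᵐ x ∂μ, x ∈ K := by
          filter_upwards [measure_eq_zero_iff_ae_notMem.1 hμ] with x hx
          simpa using hx
        have hi : ∀ i : Fin n, Integrable (fun x : Rn n => x i) μ := by
          intro i
          apply Integrable.of_bound (C := R) (by fun_prop)
          filter_upwards [hae] with x hx
          exact (PiLp.norm_apply_le x i).trans (hR x hx)
        have h1 : f =ᵐ[μ] fun x => (∑ i, l (EuclideanSpace.single i 1) * x i) + c := by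
          filter_upwards [hae] with x hx
          rw [hf x hx, hl x]
        rw [integral_congr_ae h1, integral_add
          (integrable_finsetSum _ fun i _ => (hi i).const_mul _) (integrable_const c),
          integral_finsetSum _ (fun i _ => (hi i).const_mul _)]
        simp only [integral_const_mul, integral_const, smul_eq_mul]
        ring
      simp only [sI_apply]
      rw [hint _ (hnull K hK).1, hint _ (hnull K hK).2]
      have hg := glob K hK
      rw [sm_apply _ _ MeasurableSet.univ] at hg
      have h3 : ∑ i, l (EuclideanSpace.single i 1) *
            (∫ x, x i ∂(M K).toJordanDecomposition.posPart) -
          ∑ i, l (EuclideanSpace.single i 1) *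
            (∫ x, x i ∂(M K).toJordanDecomposition.negPart) = 0 := by
        rw [← Finset.sum_sub_distrib]
        apply Finset.sum_eq_zero
        intro i _
        rw [← mul_sub, coord K hK i, mul_zero]
      linear_combination h3 + c * hg
  intro K hK
  have h0 := IHn_all n (Rn n) (by simp) _ hcurv K hK
  have heq : (M K).toJordanDecomposition.posPart = (M K).toJordanDecomposition.negPart := by
    apply ext_of_forall_integral_eq_of_IsFiniteMeasure
    intro f
    have := DFunLike.congr_fun h0 f
    rw [sI_apply] at this
    simpa [sub_eq_zero] using this
  ext β hβ
  rw [sm_apply _ _ hβ, heq]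
  simp

lemma cm_re (μ : ComplexMeasure (Rn n)) (f : Rn n → ℝ) :
    (cmIntegral μ (fun x => (f x : ℂ))).re =
      (∫ x, f x ∂(ComplexMeasure.re μ).toJordanDecomposition.posPart)
      - ∫ x, f x ∂(ComplexMeasure.re μ).toJordanDecomposition.negPart := by
  simp [cmIntegral, integral_complex_ofReal]

lemma cm_im (μ : ComplexMeasure (Rn n)) (f : Rn n → ℝ) :
    (cmIntegral μ (fun x => (f x : ℂ))).im =
      (∫ x, f x ∂(ComplexMeasure.im μ).toJordanDecomposition.posPart)
      - ∫ x, f x ∂(ComplexMeasure.im μ).toJordanDecomposition.negPart := by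
  simp [cmIntegral, integral_complex_ofReal]

lemma re_app (μ : ComplexMeasure (Rn n)) (β : Set (Rn n)) :
    ComplexMeasure.re μ β = (μ β).re := by
  simp [ComplexMeasure.re, VectorMeasure.mapRangeₗ]

lemma im_app (μ : ComplexMeasure (Rn n)) (β : Set (Rn n)) :
    ComplexMeasure.im μ β = (μ β).im := by
  simp [ComplexMeasure.im, VectorMeasure.mapRangeₗ]

noncomputable def cplx (f : Rn n →ᵇ ℝ) : Rn n →ᵇ ℂ :=
  BoundedContinuousFunction.ofNormedAddCommGroup (fun x => (f x : ℂ)) (by fun_prop) ‖f‖ (by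
    intro x; rw [Complex.norm_real]; exact f.norm_coe_le_norm x)

lemma cm_trans (Φ : CurvatureMeasure n) (K : Set (Rn n)) (hK : CB K) (x : Rn n) (β : Set (Rn n))
    (hβ : MeasurableSet β) :
    Φ.meas ((fun y => y + x) '' K) β = Φ.meas K ((fun y => y + x) ⁻¹' β) := by
  have hm : Measurable (fun z : Rn n => z + x) := by fun_prop
  have := Φ.translation_invariant K hK x _ (hm hβ)
  rwa [Set.image_preimage_eq _ (fun z => ⟨z - x, by simp⟩)] at this

end Final

/-- Injectivity of the Bernig embedding: a translation invariant curvature measure that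
globalizes to zero and whose coordinate integrals all vanish is identically zero. -/
theorem curvatureMeasure_eq_zero_of_glob_and_coords_eq_zero (n : ℕ) (Φ : CurvatureMeasure n)
    (hglob : ∀ K : Set (Rn n), IsConvexBody K → Φ.meas K Set.univ = 0)
    (hcoord : ∀ K : Set (Rn n), IsConvexBody K → ∀ i : Fin n,
      cmIntegral (Φ.meas K) (fun x => ((x i : ℝ) : ℂ)) = 0) :
    ∀ K : Set (Rn n), IsConvexBody K → ∀ β : Set (Rn n), MeasurableSet β →
      Φ.meas K β = 0 := by
  intro K hK β hβ
  have hre : ComplexMeasure.re (Φ.meas K) = 0 := by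
    apply signed_main (fun K => ComplexMeasure.re (Φ.meas K)) _ _ _ _ _ K hK
    · intro K L U hK hL hU hKL β hβ hβU
      simp only [re_app, Φ.locality K L U hK hL hU hKL β hβ hβU]
    · intro K hK x β hβ
      simp only [re_app, cm_trans Φ K hK x β hβ]
    · intro Ki K hKi hK hd f
      have h := (Complex.continuous_re.tendsto _).comp (Φ.continuity Ki K hKi hK hd (cplx f))
      have e : ∀ μ : ComplexMeasure (Rn n), (cmIntegral μ (cplx f)).re = sI (ComplexMeasure.re μ) f :=
        fun μ => cm_re μ f
      simpa only [Function.comp_def, e] using h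
    · intro K hK
      show ComplexMeasure.re (Φ.meas K) Set.univ = 0
      rw [re_app, hglob K hK]; rfl
    · intro K hK i
      rw [← cm_re (Φ.meas K) (fun x => x i), hcoord K hK i]; rfl
  have him : ComplexMeasure.im (Φ.meas K) = 0 := by
    apply signed_main (fun K => ComplexMeasure.im (Φ.meas K)) _ _ _ _ _ K hK
    · intro K L U hK hL hU hKL β hβ hβU
      simp only [im_app, Φ.locality K L U hK hL hU hKL β hβ hβU]
    · intro K hK x β hβ
      simp only [im_app, cm_trans Φ K hK x β hβ]
    · intro Ki K hKi hK hd f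
      have h := (Complex.continuous_im.tendsto _).comp (Φ.continuity Ki K hKi hK hd (cplx f))
      have e : ∀ μ : ComplexMeasure (Rn n), (cmIntegral μ (cplx f)).im = sI (ComplexMeasure.im μ) f :=
        fun μ => cm_im μ f
      simpa only [Function.comp_def, e] using h
    · intro K hK
      show ComplexMeasure.im (Φ.meas K) Set.univ = 0
      rw [im_app, hglob K hK]; rfl
    · intro K hK i
      rw [← cm_im (Φ.meas K) (fun x => x i), hcoord K hK i]; rfl
  apply Complex.ext
  · rw [← re_app, hre]; rfl
  · rw [← im_app, him]; rfl
end
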